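/- arXiv:math/9804087 — 3 statements merged into one kernel-verified Lean document; each statement's English description precedes it below -/
import Mathlib

section
/- For complex parameters with Re(b_i) > 0 for all i and Re(c − Σ b_i) > 0, and for y_1,...,y_m with Re(y_i) < 0, the Lauricella function F_B^{[m]}(a,b;c|y) equals Γ(c) times the integral over the simplex {u_i ≥ 0, Σu_i ≤ 1} of ∏_i [u_i^{b_i−1}/Γ(b_i)] · (1−u_i y_i)^{−a_i} · (1−Σu_i)^{c−Σb_i−1}/Γ(c−Σb_i) du_1...du_m. -/
open Finset MeasureTheory

/-- The Pochhammer symbol `(x)_k = x (x+1) ⋯ (x+k−1)`. -/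
noncomputable def poch (x : ℂ) (k : ℕ) : ℂ := ∏ j ∈ Finset.range k, (x + j)

/-- The Lauricella hypergeometric series of type B. -/
noncomputable def lauricellaB (m : ℕ) (a b : Fin m → ℂ) (c : ℂ) (y : Fin m → ℂ) : ℂ :=
  ∑' k : Fin m → ℕ,
    (∏ i, poch (a i) (k i) * poch (b i) (k i)) /
      (poch c (∑ i, k i) * ∏ i, ((k i).factorial : ℂ)) * ∏ i, y i ^ k i

theorem eval_ascPochhammer_eq_poch (a : ℂ) (k : ℕ) : (ascPochhammer ℂ k).eval a = poch a k := by
  induction k with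
  | zero => simp [poch]
  | succ k ih => rw [ascPochhammer_succ_eval, ih, poch, poch, Finset.prod_range_succ]

theorem choose_add_sub_one_eq_poch_div (a : ℂ) (k : ℕ) :
    Ring.choose (a + k - 1) k = poch a k / k.factorial := by
  have h := Ring.factorial_nsmul_multichoose_eq_ascPochhammer a k
  rw [Polynomial.ascPochhammer_smeval_eq_eval, eval_ascPochhammer_eq_poch, nsmul_eq_mul] at h
  rw [eq_div_iff (Nat.cast_ne_zero.2 k.factorial_ne_zero), mul_comm, Ring.choose, ← h]
  congr 2
  ring

theorem hasSum_poch_mul_pow (a : ℂ) {x : ℂ} (hx : ‖x‖ < 1) :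
    HasSum (fun k : ℕ => poch a k / k.factorial * x ^ k) ((1 - x) ^ (-a)) := by
  have h := (Complex.one_div_one_sub_cpow_hasFPowerSeriesOnBall_zero a).hasSum (y := x)
    (by simpa [enorm_eq_nnnorm, ← NNReal.coe_lt_coe] using hx)
  simpa [Complex.cpow_neg, choose_add_sub_one_eq_poch_div, mul_comm] using h

theorem summable_norm_poch_mul_pow (a : ℂ) {x : ℂ} (hx : ‖x‖ < 1) :
    Summable fun k : ℕ => ‖poch a k / k.factorial * x ^ k‖ :=
  (hasSum_poch_mul_pow a hx).summable.norm

theorem hasSum_fin_prod {m : ℕ} {f : Fin m → ℕ → ℂ} {s : Fin m → ℂ}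
    (hf : ∀ i, HasSum (f i) (s i)) (hn : ∀ i, Summable fun k => ‖f i k‖) :
    HasSum (fun k : Fin m → ℕ => ∏ i, f i (k i)) (∏ i, s i) ∧
      Summable fun k : Fin m → ℕ => ‖∏ i, f i (k i)‖ := by
  induction m with
  | zero => exact ⟨by simp, .of_finite⟩
  | succ m ih =>
    obtain ⟨h1, h2⟩ := ih (fun i => hf i.succ) (fun i => hn i.succ)
    have hs := Summable.mul_norm (hn 0) h2
    have hm := HasSum.mul (hf 0) h1 hs.of_norm
    let e : ℕ × (Fin m → ℕ) ≃ (Fin (m + 1) → ℕ) := Fin.consEquiv fun _ : Fin (m + 1) => ℕ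
    have he (p : ℕ × (Fin m → ℕ)) :
        ∏ i, f i (e p i) = f 0 p.1 * ∏ i : Fin m, f i.succ (p.2 i) := by
      simp [e, Fin.prod_univ_succ]
    rw [← e.hasSum_iff, ← e.summable_iff, Fin.prod_univ_succ]
    simp only [Function.comp_def, he]
    exact ⟨hm, hs⟩

theorem Gamma_add_nat_eq_poch_mul {b : ℂ} (hb : 0 < b.re) (k : ℕ) :
    Complex.Gamma (b + k) = poch b k * Complex.Gamma b := by
  induction k with
  | zero => simp [poch]
  | succ k ih =>
    have : b + k ≠ 0 := fun h => by
      have := congrArg Complex.re h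
      simp at this
      linarith [(Nat.cast_nonneg k : (0 : ℝ) ≤ k)]
    rw [Nat.cast_succ, ← add_assoc, Complex.Gamma_add_one _ this, ih, poch, poch,
      Finset.prod_range_succ]
    ring

/-- The power kernel `x_+^(γ-1) / Γ(γ)`. -/
noncomputable def powerKernel (γ : ℂ) (x : ℝ) : ℂ :=
  if 0 ≤ x then (x : ℂ) ^ (γ - 1) / Complex.Gamma γ else 0

theorem powerKernel_of_neg (γ : ℂ) {x : ℝ} (hx : x < 0) : powerKernel γ x = 0 :=
  if_neg hx.not_ge

theorem powerKernel_of_nonneg (γ : ℂ) {x : ℝ} (hx : 0 ≤ x) :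
    powerKernel γ x = (x : ℂ) ^ (γ - 1) / Complex.Gamma γ :=
  if_pos hx

theorem measurable_powerKernel (γ : ℂ) : Measurable (powerKernel γ) :=
  Measurable.ite measurableSet_Ici (by fun_prop) measurable_const

theorem norm_powerKernel_ofReal {r : ℝ} (hr : 0 < r) (x : ℝ) :
    (‖powerKernel r x‖ : ℂ) = powerKernel r x := by
  rcases lt_or_ge x 0 with hx | hx
  · simp [powerKernel_of_neg _ hx]
  · have h : powerKernel r x = ((x ^ (r - 1) / Real.Gamma r : ℝ) : ℂ) := by
      rw [powerKernel_of_nonneg _ hx, Complex.Gamma_ofReal, Complex.ofReal_div,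
        Complex.ofReal_cpow hx]
      push_cast
      rfl
    rw [h, Complex.norm_real, Real.norm_of_nonneg]
    exact div_nonneg (Real.rpow_nonneg hx _) (Real.Gamma_pos_of_pos hr).le

theorem norm_powerKernel_le {γ : ℂ} (hγ : 0 < γ.re) (x : ℝ) :
    ‖powerKernel γ x‖ ≤
      ‖Complex.Gamma γ.re‖ / ‖Complex.Gamma γ‖ * ‖powerKernel γ.re x‖ := by
  have h0 : ‖Complex.Gamma γ.re‖ ≠ 0 :=
    norm_ne_zero_iff.2 (Complex.Gamma_ne_zero_of_re_pos (by simpa using hγ))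
  rcases lt_or_ge x 0 with hx | hx
  · simp [powerKernel_of_neg _ hx]
  · rw [powerKernel_of_nonneg _ hx, powerKernel_of_nonneg _ hx, norm_div, norm_div,
      div_mul_div_comm, mul_comm, mul_div_mul_right _ _ h0]
    gcongr
    rcases hx.eq_or_lt with rfl | hx
    · by_cases h : γ = 1
      · simp [h]
      · simp [Complex.zero_cpow (sub_ne_zero.2 h)]
    · simp [Complex.norm_cpow_eq_rpow_re_of_pos hx]

theorem powerKernel_convolution {β γ : ℂ} (hβ : 0 < β.re) (hγ : 0 < γ.re) {s : ℝ} (hs : s ≠ 0) :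
    Integrable (fun u => powerKernel β u * powerKernel γ (s - u)) ∧
      ∫ u, powerKernel β u * powerKernel γ (s - u) = powerKernel (β + γ) s := by
  rcases hs.lt_or_gt with hs | hs
  · have h : (fun u => powerKernel β u * powerKernel γ (s - u)) = 0 := by
      ext u
      rcases lt_or_ge u 0 with hu | hu
      · simp [powerKernel_of_neg _ hu]
      · simp [powerKernel_of_neg γ (x := s - u) (by linarith)]
    simp [h, powerKernel_of_neg _ hs, integrable_zero]
  · set g : ℝ → ℂ := fun u => (u : ℂ) ^ (β - 1) * ((s : ℂ) - u) ^ (γ - 1)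
    have hΓβ := Complex.Gamma_ne_zero_of_re_pos hβ
    have hΓγ := Complex.Gamma_ne_zero_of_re_pos hγ
    have hΓ : Complex.Gamma (β + γ) ≠ 0 :=
      Complex.Gamma_ne_zero_of_re_pos (by simpa using add_pos hβ hγ)
    have h : (fun u => powerKernel β u * powerKernel γ (s - u)) =
        (Set.Icc 0 s).indicator
          fun u => (Complex.Gamma β * Complex.Gamma γ)⁻¹ * g u := by
      ext u
      by_cases hu : u ∈ Set.Icc 0 s
      · rw [Set.indicator_of_mem hu, powerKernel_of_nonneg _ hu.1,
          powerKernel_of_nonneg _ (sub_nonneg.2 hu.2)]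
        simp only [g]
        push_cast
        field_simp
      · rw [Set.indicator_of_notMem hu]
        rcases lt_or_ge u 0 with hu' | hu'
        · simp [powerKernel_of_neg _ hu']
        · have : s - u < 0 := by
            by_contra! h
            exact hu ⟨hu', by linarith⟩
          simp [powerKernel_of_neg γ this]
    have hB := Complex.Gamma_mul_Gamma_eq_betaIntegral hβ hγ
    have hI : ∫ u in (0 : ℝ)..s, g u = (s : ℂ) ^ (β + γ - 1) * Complex.betaIntegral β γ :=
      Complex.betaIntegral_scaled β γ hs
    have hint : IntervalIntegrable g volume 0 s := by
      by_contra hn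
      rw [intervalIntegral.integral_undef hn, eq_comm, mul_eq_zero] at hI
      rcases hI with hI | hI
      · exact hs.ne' (by simpa using (Complex.cpow_eq_zero_iff _ _).1 hI |>.1)
      · rw [hI, mul_zero] at hB
        exact mul_ne_zero hΓβ hΓγ hB
    rw [h, integrable_indicator_iff measurableSet_Icc, integral_indicator measurableSet_Icc,
      integral_const_mul, integral_Icc_eq_integral_Ioc, ← intervalIntegral.integral_of_le hs.le, hI,
      powerKernel_of_nonneg _ hs.le]
    refine ⟨((intervalIntegrable_iff_integrableOn_Icc_of_le hs.le).1 hint).const_mul _, ?_⟩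
    field_simp
    linear_combination -(s : ℂ) ^ (β + γ - 1) * hB

/-- The unnormalized Dirichlet density with parameters `β`, `γ` on the simplex of size `s`,
as a function on the whole space. -/
noncomputable def dirichletKernel {m : ℕ} (β : Fin m → ℂ) (γ : ℂ) (s : ℝ) (u : Fin m → ℝ) : ℂ :=
  (∏ i, powerKernel (β i) (u i)) * powerKernel γ (s - ∑ i, u i)

theorem measurable_dirichletKernel {m : ℕ} (β : Fin m → ℂ) (γ : ℂ) (s : ℝ) :
    Measurable (dirichletKernel β γ s) := by
  unfold dirichletKernel
  refine .mul (Finset.measurable_fun_prod _ fun i _ => ?_) ?_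
  · exact (measurable_powerKernel _).comp (measurable_pi_apply i)
  · exact (measurable_powerKernel _).comp (by fun_prop)

theorem norm_dirichletKernel_ofReal {m : ℕ} {β : Fin m → ℝ} {γ : ℝ} (hβ : ∀ i, 0 < β i)
    (hγ : 0 < γ) (s : ℝ) (u : Fin m → ℝ) :
    (‖dirichletKernel (fun i => (β i : ℂ)) γ s u‖ : ℂ) =
      dirichletKernel (fun i => (β i : ℂ)) γ s u := by
  simp only [dirichletKernel, norm_mul, norm_prod, Complex.ofReal_mul, Complex.ofReal_prod,
    norm_powerKernel_ofReal hγ, fun i => norm_powerKernel_ofReal (hβ i)]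

theorem exists_norm_dirichletKernel_le {m : ℕ} {β : Fin m → ℂ} {γ : ℂ} (hβ : ∀ i, 0 < (β i).re)
    (hγ : 0 < γ.re) (s : ℝ) :
    ∃ C : ℝ, ∀ u, ‖dirichletKernel β γ s u‖ ≤
      C * ‖dirichletKernel (fun i => ((β i).re : ℂ)) γ.re s u‖ := by
  refine ⟨(∏ i, ‖Complex.Gamma (β i).re‖ / ‖Complex.Gamma (β i)‖) *
    (‖Complex.Gamma γ.re‖ / ‖Complex.Gamma γ‖), fun u => ?_⟩
  simp only [dirichletKernel, norm_mul, norm_prod]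
  rw [mul_mul_mul_comm, ← Finset.prod_mul_distrib]
  gcongr with i
  · exact norm_powerKernel_le (hβ i) _
  · exact norm_powerKernel_le hγ _

theorem dirichletKernel_cons {m : ℕ} (β : Fin (m + 1) → ℂ) (γ : ℂ) (s x : ℝ) (v : Fin m → ℝ) :
    dirichletKernel β γ s (Fin.cons x v) =
      powerKernel (β 0) x * dirichletKernel (fun i => β i.succ) γ (s - x) v := by
  simp only [dirichletKernel, Fin.prod_univ_succ, Fin.sum_univ_succ, Fin.cons_zero, Fin.cons_succ,
    mul_assoc, sub_add_eq_sub_sub]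

theorem dirichletKernel_integral {m : ℕ} {β : Fin m → ℂ} {γ : ℂ} (hβ : ∀ i, 0 < (β i).re)
    (hγ : 0 < γ.re) {s : ℝ} (hs : s ≠ 0) :
    Integrable (dirichletKernel β γ s) ∧
      ∫ u, dirichletKernel β γ s u = powerKernel (∑ i, β i + γ) s := by
  induction m generalizing γ s with
  | zero =>
    rw [volume_pi, Measure.pi_of_empty]
    exact ⟨integrable_dirac (by finiteness), by simp [dirichletKernel]⟩
  | succ m ih =>
    let e := MeasurableEquiv.piFinSuccAbove (fun _ : Fin (m + 1) => ℝ) 0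
    have he : MeasurePreserving e.symm (volume.prod volume) volume :=
      (volume_preserving_piFinSuccAbove (fun _ : Fin (m + 1) => ℝ) 0).symm e
    have hcomp (β : Fin (m + 1) → ℂ) (γ : ℂ) (p : ℝ × (Fin m → ℝ)) :
        dirichletKernel β γ s (e.symm p) =
          powerKernel (β 0) p.1 * dirichletKernel (fun i => β i.succ) γ (s - p.1) p.2 := by
      have hp : e.symm p = Fin.cons p.1 p.2 := by
        simp [e, MeasurableEquiv.piFinSuccAbove_symm_apply]
        rfl
      rw [hp, dirichletKernel_cons]
    have hmeas (β : Fin (m + 1) → ℂ) (γ : ℂ) :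
        AEStronglyMeasurable (fun p => dirichletKernel β γ s (e.symm p)) (volume.prod volume) :=
      ((measurable_dirichletKernel β γ s).comp e.symm.measurable).aestronglyMeasurable
    have hne : ∀ᵐ x : ℝ, s - x ≠ 0 := by
      filter_upwards [Measure.ae_ne volume s] with x hx
      exact sub_ne_zero.2 hx.symm
    have hsum {β : Fin (m + 1) → ℂ} (hβ : ∀ i, 0 < (β i).re) {γ : ℂ} (hγ : 0 < γ.re) :
        0 < (∑ i : Fin m, β i.succ + γ).re := by
      rw [Complex.add_re, Complex.re_sum]
      exact add_pos_of_nonneg_of_pos (Finset.sum_nonneg fun i _ => (hβ _).le) hγ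
    have hreal : Integrable (fun p => dirichletKernel (fun i => ((β i).re : ℂ)) γ.re s (e.symm p))
        (volume.prod volume) := by
      have hβ' : ∀ i, 0 < (((β i).re : ℝ) : ℂ).re := by simpa using hβ
      have hγ' : 0 < ((γ.re : ℝ) : ℂ).re := by simpa using hγ
      rw [integrable_prod_iff (hmeas _ _)]
      simp only [hcomp]
      refine ⟨?_, ?_⟩
      · filter_upwards [hne] with x hx
        exact (ih (fun i => hβ' i.succ) hγ' hx).1.const_mul _
      · refine (powerKernel_convolution (hβ' 0) (hsum hβ' hγ') hs).1.norm.congr ?_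
        filter_upwards [hne] with x hx
        rw [norm_mul, ← (ih (fun i => hβ' i.succ) hγ' hx).2]
        simp only [norm_mul, integral_const_mul]
        congr 1
        rw [← integral_congr_ae (.of_forall
          (norm_dirichletKernel_ofReal (fun i : Fin m => hβ i.succ) hγ (s - x))),
          integral_complex_ofReal, Complex.norm_real,
          Real.norm_of_nonneg (integral_nonneg fun _ => norm_nonneg _)]
    have hint : Integrable (fun p => dirichletKernel β γ s (e.symm p)) (volume.prod volume) := by
      obtain ⟨C, hC⟩ := exists_norm_dirichletKernel_le hβ hγ s
      exact (hreal.norm.const_mul C).mono' (hmeas _ _) (.of_forall fun p => hC _)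
    refine ⟨(he.integrable_comp_emb e.symm.measurableEmbedding).1 hint, ?_⟩
    rw [← he.integral_comp', integral_prod _ hint, Fin.sum_univ_succ, add_assoc,
      ← (powerKernel_convolution (hβ 0) (hsum hβ hγ) hs).2]
    refine integral_congr_ae ?_
    filter_upwards [hne] with x hx
    simp only [hcomp, integral_const_mul, (ih (fun i => hβ i.succ) hγ hx).2]

theorem powerKernel_mul_pow {b : ℂ} (hb : 0 < b.re) (k : ℕ) (x : ℝ) :
    powerKernel b x * (x : ℂ) ^ k = poch b k * powerKernel (b + k) x := by
  rcases lt_or_ge x 0 with hx | hx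
  · simp [powerKernel_of_neg _ hx]
  have hΓ := Complex.Gamma_ne_zero_of_re_pos hb
  have hbk : 0 < (b + k).re := by
    simpa using add_pos_of_pos_of_nonneg hb k.cast_nonneg
  have hΓk := Complex.Gamma_ne_zero_of_re_pos hbk
  have hpow : (x : ℂ) ^ (b + k - 1) = (x : ℂ) ^ (b - 1) * (x : ℂ) ^ k := by
    rcases hx.eq_or_lt with rfl | hx
    · rcases k.eq_zero_or_pos with rfl | hk
      · simp
      · have hne : b + k - 1 ≠ 0 := fun h => by
          have h1 := congrArg Complex.re h
          have h2 : (1 : ℝ) ≤ k := by exact_mod_cast hk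
          simp at h1
          linarith
        simp [Complex.zero_cpow hne, hk.ne']
    · rw [add_sub_right_comm, Complex.cpow_add _ _ (by exact_mod_cast hx.ne'),
        Complex.cpow_natCast]
  rw [Gamma_add_nat_eq_poch_mul hb] at hΓk
  rw [powerKernel_of_nonneg _ hx, powerKernel_of_nonneg _ hx, hpow, Gamma_add_nat_eq_poch_mul hb]
  have := left_ne_zero_of_mul hΓk
  field_simp

theorem dirichletKernel_mul_prod_pow {m : ℕ} {b : Fin m → ℂ} (hb : ∀ i, 0 < (b i).re) (γ : ℂ)
    (s : ℝ) (k : Fin m → ℕ) (u : Fin m → ℝ) :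
    dirichletKernel b γ s u * ∏ i, (u i : ℂ) ^ k i =
      (∏ i, poch (b i) (k i)) * dirichletKernel (fun i => b i + k i) γ s u := by
  rw [dirichletKernel, dirichletKernel, mul_right_comm, ← Finset.prod_mul_distrib, ← mul_assoc,
    ← Finset.prod_mul_distrib]
  simp only [fun i => powerKernel_mul_pow (hb i)]

/-- The solid unit simplex `{u | 0 ≤ u i, ∑ i, u i ≤ 1}`. -/
def solidSimplex (m : ℕ) : Set (Fin m → ℝ) :=
  {u | (∀ i, 0 ≤ u i) ∧ ∑ i, u i ≤ 1}

theorem isClosed_solidSimplex (m : ℕ) : IsClosed (solidSimplex m) := by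
  simp only [solidSimplex, Set.ofPred_and, Set.ofPred_forall]
  exact (isClosed_iInter fun i => isClosed_le continuous_const (continuous_apply i)).inter
    (isClosed_le (by fun_prop) continuous_const)

theorem apply_le_one_of_mem_solidSimplex {m : ℕ} {u : Fin m → ℝ} (hu : u ∈ solidSimplex m)
    (i : Fin m) : u i ≤ 1 :=
  (Finset.single_le_sum (fun j _ => hu.1 j) (Finset.mem_univ i)).trans hu.2

theorem isCompact_solidSimplex (m : ℕ) : IsCompact (solidSimplex m) :=
  (isCompact_Icc (a := (0 : Fin m → ℝ)) (b := 1)).of_isClosed_subset (isClosed_solidSimplex m)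
    fun _ hu => ⟨hu.1, apply_le_one_of_mem_solidSimplex hu⟩

theorem dirichletKernel_one_of_notMem {m : ℕ} (β : Fin m → ℂ) (γ : ℂ) {u : Fin m → ℝ}
    (hu : u ∉ solidSimplex m) : dirichletKernel β γ 1 u = 0 := by
  by_cases h : ∀ i, 0 ≤ u i
  · have : 1 - ∑ i, u i < 0 := by
      by_contra! h'
      exact hu ⟨h, by linarith⟩
    rw [dirichletKernel, powerKernel_of_neg _ this, mul_zero]
  · push Not at h
    obtain ⟨i, hi⟩ := h
    rw [dirichletKernel, Finset.prod_eq_zero (Finset.mem_univ i) (powerKernel_of_neg _ hi),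
      zero_mul]

theorem dirichletKernel_one_of_mem {m : ℕ} (β : Fin m → ℂ) (γ : ℂ) {u : Fin m → ℝ}
    (hu : u ∈ solidSimplex m) :
    dirichletKernel β γ 1 u = (∏ i, (u i : ℂ) ^ (β i - 1) / Complex.Gamma (β i)) *
      (((1 - ∑ i, u i : ℝ) : ℂ) ^ (γ - 1) / Complex.Gamma γ) := by
  rw [dirichletKernel, powerKernel_of_nonneg _ (sub_nonneg.2 hu.2)]
  simp only [fun i => powerKernel_of_nonneg (β i) (hu.1 i)]

/-- The analytic factor `∏ (1 - u_i y_i)^(-a_i)` of the Euler integrand. -/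
noncomputable def eulerFactor {m : ℕ} (a y : Fin m → ℂ) (u : Fin m → ℝ) : ℂ :=
  ∏ i, (1 - (u i : ℂ) * y i) ^ (-(a i))

theorem lauricellaB_eq_integral {m : ℕ} (a : Fin m → ℂ) {b : Fin m → ℂ} {c : ℂ}
    (hb : ∀ i, 0 < (b i).re) (hcb : 0 < (c - ∑ i, b i).re) {y : Fin m → ℂ}
    (hy : ∀ i, ‖y i‖ < 1) :
    lauricellaB m a b c y = Complex.Gamma c *
      ∫ u in solidSimplex m, dirichletKernel b (c - ∑ i, b i) 1 u * eulerFactor a y u := by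
  set γ := c - ∑ i, b i with hγ
  have hc : 0 < c.re := by
    have : c = γ + ∑ i, b i := by simp [hγ]
    rw [this, Complex.add_re, Complex.re_sum]
    exact add_pos_of_pos_of_nonneg hcb (Finset.sum_nonneg fun i _ => (hb i).le)
  have hmeas := (isClosed_solidSimplex m).measurableSet
  let B (k : Fin m → ℕ) : ℂ := ∏ i, (poch (a i) (k i) / (k i).factorial * y i ^ k i)
  let F (k : Fin m → ℕ) (u : Fin m → ℝ) : ℂ :=
    dirichletKernel b γ 1 u * ∏ i, (poch (a i) (k i) / (k i).factorial * (u i * y i) ^ k i)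
  have hnorm {u : Fin m → ℝ} (hu : u ∈ solidSimplex m) (i : Fin m) : ‖(u i : ℂ)‖ ≤ 1 := by
    rw [Complex.norm_real, Real.norm_of_nonneg (hu.1 i)]
    exact apply_le_one_of_mem_solidSimplex hu i
  have hF (k : Fin m → ℕ) (u : Fin m → ℝ) :
      F k u = B k * (dirichletKernel b γ 1 u * ∏ i, (u i : ℂ) ^ k i) := by
    simp only [F, B, mul_pow, Finset.prod_mul_distrib]
    ring
  have hF' (k : Fin m → ℕ) : F k = fun u => B k * (∏ i, poch (b i) (k i)) *
      dirichletKernel (fun i => b i + k i) γ 1 u := by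
    ext u
    rw [hF, dirichletKernel_mul_prod_pow hb, mul_assoc]
  have hbk (k : Fin m → ℕ) (i : Fin m) : 0 < (b i + k i).re := by
    simpa using add_pos_of_pos_of_nonneg (hb i) (k i).cast_nonneg
  have hD := dirichletKernel_integral hb hcb one_ne_zero
  have hFint (k : Fin m → ℕ) : Integrable (F k) (volume.restrict (solidSimplex m)) := by
    rw [hF']
    exact ((dirichletKernel_integral (hbk k) hcb one_ne_zero).1.const_mul _).restrict
  have hFle (k : Fin m → ℕ) : ∫ u in solidSimplex m, ‖F k u‖ ≤
      ‖B k‖ * ∫ u in solidSimplex m, ‖dirichletKernel b γ 1 u‖ := by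
    rw [← integral_const_mul]
    refine setIntegral_mono_on (hFint k).norm (hD.1.norm.const_mul _).restrict hmeas fun u hu => ?_
    rw [hF, norm_mul, norm_mul]
    gcongr
    refine mul_le_of_le_one_right (norm_nonneg _) ?_
    rw [norm_prod]
    refine Finset.prod_le_one (fun _ _ => norm_nonneg _) fun i _ => ?_
    rw [norm_pow]
    exact pow_le_one₀ (norm_nonneg _) (hnorm hu i)
  have hB : Summable fun k => ‖B k‖ :=
    (hasSum_fin_prod (fun i => hasSum_poch_mul_pow (a i) (hy i))
      fun i => summable_norm_poch_mul_pow (a i) (hy i)).2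
  have hsum := hasSum_integral_of_summable_integral_norm hFint
    (.of_nonneg_of_le (fun k => integral_nonneg fun _ => norm_nonneg _) hFle (hB.mul_right _))
  have htsum : ∫ u in solidSimplex m, ∑' k, F k u =
      ∫ u in solidSimplex m, dirichletKernel b γ 1 u * eulerFactor a y u := by
    refine setIntegral_congr_fun hmeas fun u hu => ?_
    have huy (i : Fin m) : ‖(u i : ℂ) * y i‖ < 1 := by
      rw [norm_mul]
      exact (mul_le_of_le_one_left (norm_nonneg _) (hnorm hu i)).trans_lt (hy i)
    exact ((hasSum_fin_prod (fun i => hasSum_poch_mul_pow (a i) (huy i))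
      fun i => summable_norm_poch_mul_pow (a i) (huy i)).1.mul_left _).tsum_eq
  rw [← htsum, ← (hsum.mul_left (Complex.Gamma c)).tsum_eq, lauricellaB]
  refine tsum_congr fun k => ?_
  have hΓ : Complex.Gamma (c + (∑ i, k i : ℕ)) ≠ 0 := Complex.Gamma_ne_zero_of_re_pos
    (by simpa using add_pos_of_pos_of_nonneg hc (Nat.cast_nonneg (∑ i, k i)))
  have hexp : ∑ i, (b i + k i) + γ = c + (∑ i, k i : ℕ) := by
    rw [Finset.sum_add_distrib, hγ]
    push_cast
    ring
  rw [setIntegral_eq_integral_of_forall_compl_eq_zero fun u hu => by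
      simp only [hF', dirichletKernel_one_of_notMem _ _ hu, mul_zero],
    hF', integral_const_mul, (dirichletKernel_integral (hbk k) hcb one_ne_zero).2, hexp,
    powerKernel_of_nonneg _ zero_le_one, Complex.ofReal_one, Complex.one_cpow]
  rw [Gamma_add_nat_eq_poch_mul hc] at hΓ ⊢
  have h1 := left_ne_zero_of_mul hΓ
  have h2 := right_ne_zero_of_mul hΓ
  have h3 : ∏ i, ((k i).factorial : ℂ) ≠ 0 :=
    Finset.prod_ne_zero_iff.2 fun i _ => Nat.cast_ne_zero.2 (k i).factorial_ne_zero
  simp only [B, Finset.prod_mul_distrib, Finset.prod_div_distrib]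
  field_simp

/-- The multipliers `t` for which every `t * y i` lies in the left half-plane or the unit disc. -/
def multiplierDomain {m : ℕ} (y : Fin m → ℂ) : Set ℂ :=
  {t | ∀ i, (t * y i).re < 0 ∨ ‖t * y i‖ < 1}

theorem isOpen_multiplierDomain {m : ℕ} (y : Fin m → ℂ) : IsOpen (multiplierDomain y) := by
  simp only [multiplierDomain, Set.ofPred_forall, Set.ofPred_or]
  exact isOpen_iInter_of_finite fun i =>
    (isOpen_lt (by fun_prop) continuous_const).union (isOpen_lt (by fun_prop) continuous_const)

theorem zero_mem_multiplierDomain {m : ℕ} (y : Fin m → ℂ) : (0 : ℂ) ∈ multiplierDomain y :=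
  fun i => .inr (by simp)

theorem isPreconnected_multiplierDomain {m : ℕ} (y : Fin m → ℂ) :
    IsPreconnected (multiplierDomain y) := by
  have h : StarConvex ℝ (0 : ℂ) (multiplierDomain y) := by
    rw [starConvex_zero_iff]
    intro t ht r hr0 hr1 i
    rw [smul_mul_assoc]
    rcases hr0.eq_or_lt with rfl | hr0
    · simp
    refine (ht i).imp (fun h => ?_) fun h => ?_
    · rw [Complex.smul_re, smul_eq_mul]
      exact mul_neg_of_pos_of_neg hr0 h
    · rw [norm_smul, Real.norm_of_nonneg hr0.le]
      exact (mul_le_of_le_one_left (norm_nonneg _) hr1).trans_lt h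
  exact (h.isPathConnected (zero_mem_multiplierDomain y)).isConnected.isPreconnected

theorem one_sub_mul_mem_slitPlane {x : ℝ} (hx0 : 0 ≤ x) (hx1 : x ≤ 1) {z : ℂ}
    (hz : z.re < 0 ∨ ‖z‖ < 1) : 1 - (x : ℂ) * z ∈ Complex.slitPlane := by
  left
  rw [Complex.sub_re, Complex.one_re, Complex.re_ofReal_mul]
  rcases hz with hz | hz
  · nlinarith
  · linarith [mul_le_mul_of_nonneg_left (Complex.re_le_norm z) hx0,
      mul_le_of_le_one_left (norm_nonneg z) hx1]

theorem differentiableOn_integral_eulerFactor {m : ℕ} (a y : Fin m → ℂ) {D : (Fin m → ℝ) → ℂ}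
    (hD : Integrable D) :
    DifferentiableOn ℂ (fun t : ℂ => ∫ u in solidSimplex m, D u * eulerFactor a (t • y) u)
      (multiplierDomain y) := by
  have hmeas := (isClosed_solidSimplex m).measurableSet
  have hslit {t : ℂ} (ht : t ∈ multiplierDomain y) {u : Fin m → ℝ} (hu : u ∈ solidSimplex m)
      (i : Fin m) : 1 - (u i : ℂ) * (t * y i) ∈ Complex.slitPlane :=
    one_sub_mul_mem_slitPlane (hu.1 i) (apply_le_one_of_mem_solidSimplex hu i) (ht i)
  have hpow (d : ℂ) (i : Fin m) : ContinuousOn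
      (fun p : ℂ × (Fin m → ℝ) => (1 - (p.2 i : ℂ) * (p.1 * y i)) ^ d)
      (multiplierDomain y ×ˢ solidSimplex m) :=
    ContinuousOn.cpow (by fun_prop) continuousOn_const fun p hp => hslit hp.1 hp.2 i
  have hE : ContinuousOn (fun p : ℂ × (Fin m → ℝ) => eulerFactor a (p.1 • y) p.2)
      (multiplierDomain y ×ˢ solidSimplex m) :=
    continuousOn_finsetProd _ fun i _ => hpow _ i
  let E' (t : ℂ) (u : Fin m → ℝ) : ℂ :=
    ∑ i, (∏ j ∈ Finset.univ.erase i, (1 - (u j : ℂ) * (t * y j)) ^ (-(a j))) •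
      (-(a i) * (1 - (u i : ℂ) * (t * y i)) ^ (-(a i) - 1) * -((u i : ℂ) * y i))
  have hE' : ContinuousOn (fun p : ℂ × (Fin m → ℝ) => E' p.1 p.2)
      (multiplierDomain y ×ˢ solidSimplex m) := by
    refine continuousOn_finsetSum _ fun i _ =>
      (continuousOn_finsetProd _ fun j _ => hpow _ j).smul ?_
    exact (continuousOn_const.mul (hpow _ i)).mul (by fun_prop)
  have hderiv {t : ℂ} (ht : t ∈ multiplierDomain y) {u : Fin m → ℝ} (hu : u ∈ solidSimplex m) :
      HasDerivAt (fun t : ℂ => eulerFactor a (t • y) u) (E' t u) t := by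
    refine HasDerivAt.fun_finsetProd fun i _ => ?_
    refine HasDerivAt.cpow_const ?_ (hslit ht hu i)
    simpa using (((hasDerivAt_id t).mul_const (y i)).const_mul (u i : ℂ)).const_sub 1
  have hslice {f : ℂ → (Fin m → ℝ) → ℂ} (hf : ContinuousOn (fun p : ℂ × (Fin m → ℝ) => f p.1 p.2)
      (multiplierDomain y ×ˢ solidSimplex m)) {t : ℂ} (ht : t ∈ multiplierDomain y) :
      ContinuousOn (f t) (solidSimplex m) :=
    hf.comp (by fun_prop : ContinuousOn (fun u => (t, u)) _) fun u hu => ⟨ht, hu⟩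
  intro t ht
  obtain ⟨r, hr, hrS⟩ := Metric.nhds_basis_closedBall.mem_iff.1
    ((isOpen_multiplierDomain y).mem_nhds ht)
  obtain ⟨M, hM⟩ := ((isCompact_closedBall t r).prod
    (isCompact_solidSimplex m)).exists_bound_of_continuousOn
    (hE'.mono (Set.prod_mono hrS subset_rfl))
  have hFmeas {s : ℂ} (hs : s ∈ multiplierDomain y) :
      AEStronglyMeasurable (fun u => D u * eulerFactor a (s • y) u)
        (volume.restrict (solidSimplex m)) :=
    hD.1.restrict.mul ((hslice (f := fun t u => eulerFactor a (t • y) u) hE hs).aestronglyMeasurable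
      hmeas)
  have hFint : Integrable (fun u => D u * eulerFactor a (t • y) u)
      (volume.restrict (solidSimplex m)) :=
    hD.integrableOn.mul_continuousOn_of_subset
      (hslice (f := fun t u => eulerFactor a (t • y) u) hE ht) hmeas (isCompact_solidSimplex m)
      subset_rfl
  refine (hasDerivAt_integral_of_dominated_loc_of_deriv_le (F' := fun s u => D u * E' s u)
    (bound := fun u => ‖D u‖ * M) (Metric.closedBall_mem_nhds t hr) ?_ hFint
    (hD.1.restrict.mul ((hslice hE' ht).aestronglyMeasurable hmeas)) ?_
    (hD.norm.mul_const M).restrict ?_).2.differentiableAt.differentiableWithinAt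
  · filter_upwards [(isOpen_multiplierDomain y).mem_nhds ht] with s hs using hFmeas hs
  · filter_upwards [ae_restrict_mem hmeas] with u hu s hs
    rw [norm_mul]
    gcongr
    exact hM (s, u) ⟨hs, hu⟩
  · filter_upwards [ae_restrict_mem hmeas] with u hu s hs
    exact (hderiv (hrS hs) hu).const_mul _

/-- Euler–Laplace integral representation of the analytic continuation of the
Lauricella function of type B to the product of left half-planes. -/
theorem lauricellaB_euler_integral (m : ℕ) (a b : Fin m → ℂ) (c : ℂ)
    (hb : ∀ i, 0 < (b i).re) (hcb : 0 < (c - ∑ i, b i).re)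
    (G : (Fin m → ℂ) → ℂ)
    (hG : AnalyticOn ℂ G {y : Fin m → ℂ | ∀ i, (y i).re < 0 ∨ ‖y i‖ < 1})
    (hGeq : ∀ y : Fin m → ℂ, (∀ i, ‖y i‖ < 1) → G y = lauricellaB m a b c y)
    (y : Fin m → ℂ) (hy : ∀ i, (y i).re < 0) :
    G y = Complex.Gamma c *
      ∫ u in {u : Fin m → ℝ | (∀ i, 0 ≤ u i) ∧ ∑ i, u i ≤ 1},
        (∏ i, ((u i : ℂ) ^ (b i - 1) / Complex.Gamma (b i)) *
            (1 - (u i : ℂ) * y i) ^ (-(a i))) *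
          (((1 - ∑ i, u i : ℝ) : ℂ) ^ (c - ∑ i, b i - 1) /
            Complex.Gamma (c - ∑ i, b i)) := by
  have hU : IsOpen (multiplierDomain y) := isOpen_multiplierDomain y
  have hG' : AnalyticOnNhd ℂ (fun t : ℂ => G (t • y)) (multiplierDomain y) :=
    hU.analyticOn_iff_analyticOnNhd.1
      (hG.comp (analyticOnNhd_id.smul analyticOnNhd_const).analyticOn fun t ht => ht)
  have hI : AnalyticOnNhd ℂ (fun t : ℂ => Complex.Gamma c * ∫ u in solidSimplex m,
      dirichletKernel b (c - ∑ i, b i) 1 u * eulerFactor a (t • y) u) (multiplierDomain y) :=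
    ((differentiableOn_integral_eulerFactor a y
      (dirichletKernel_integral hb hcb one_ne_zero).1).const_mul _).analyticOnNhd hU
  have hnear : ∀ᶠ t : ℂ in nhds 0, ∀ i, ‖(t • y) i‖ < 1 :=
    Filter.eventually_all.2 fun i =>
      (by fun_prop : Continuous fun t : ℂ => ‖(t • y) i‖).continuousAt.eventually_lt
        continuousAt_const (by simp)
  have h1 := hG'.eqOn_of_preconnected_of_eventuallyEq hI (isPreconnected_multiplierDomain y)
    (zero_mem_multiplierDomain y)
    (hnear.mono fun t ht => (hGeq _ ht).trans (lauricellaB_eq_integral a hb hcb ht))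
    (show (1 : ℂ) ∈ multiplierDomain y from fun i => .inl (by simpa using hy i))
  simp only [one_smul] at h1
  rw [h1]
  congr 1
  refine setIntegral_congr_fun (isClosed_solidSimplex m).measurableSet fun u hu => ?_
  simp only [dirichletKernel_one_of_mem _ _ hu, eulerFactor, Finset.prod_mul_distrib]
  ring
end

section
/- For complex numbers a, b, c, w with |w| > 1, w not a positive real, a − b not an integer, and a, b not nonpositive integers: F(a,b;c;w)/Γ(c) = [Γ(b−a)/(Γ(b)Γ(c−a))](−w)^{−a} F(a, 1−c+a; 1−b+a; 1/w) + [Γ(a−b)/(Γ(a)Γ(c−b))](−w)^{−b} F(b, 1−c+b; 1−a+b; 1/w), where F is the analytically continued Gauss hypergeometric function. -/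
open Finset

/-- The Gauss hypergeometric series `₂F₁(a,b;c;x)`. -/
noncomputable def hypF (a b c x : ℂ) : ℂ :=
  ∑' k : ℕ, poch a k * poch b k / (poch c k * (k.factorial : ℂ)) * x ^ k

open scoped Topology
open Filter MeasureTheory

section Series

variable {a b c x : ℂ}

@[simp]
lemma poch_zero (x : ℂ) : poch x 0 = 1 := by simp [poch]

lemma poch_succ (x : ℂ) (n : ℕ) : poch x (n + 1) = poch x n * (x + n) := by
  simp [poch, Finset.prod_range_succ]

lemma poch_succ_left (x : ℂ) (n : ℕ) : poch x (n + 1) = x * poch (x + 1) n := by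
  simp only [poch, Finset.prod_range_succ']
  push_cast
  rw [mul_comm]
  simp [add_assoc, add_comm (1 : ℂ)]

lemma mul_poch_add_one (x : ℂ) (n : ℕ) : x * poch (x + 1) n = (x + n) * poch x n := by
  rw [← poch_succ_left, poch_succ, mul_comm]

lemma poch_ne_zero (hc : ∀ n : ℕ, c ≠ -(n : ℂ)) (n : ℕ) : poch c n ≠ 0 :=
  Finset.prod_ne_zero_iff.2 fun j _ h => hc j (eq_neg_of_add_eq_zero_left h)

lemma poch_eq_ascPochhammer (x : ℂ) (n : ℕ) : poch x n = (ascPochhammer ℂ n).eval x := by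
  induction n with
  | zero => simp
  | succ n ih => rw [poch_succ, ascPochhammer_succ_eval, ih]

lemma add_one_ne_neg_natCast (hc : ∀ n : ℕ, c ≠ -(n : ℂ)) (n : ℕ) : c + 1 ≠ -(n : ℂ) := by
  intro h
  apply hc (n + 1)
  push_cast
  linear_combination h

/-- The coefficients of the Gauss hypergeometric series. -/
noncomputable def hypCoeff (a b c : ℂ) (n : ℕ) : ℂ :=
  poch a n * poch b n / (poch c n * (n.factorial : ℂ))

lemma hypF_eq_tsum (a b c x : ℂ) : hypF a b c x = ∑' n, hypCoeff a b c n * x ^ n := rfl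

lemma hypF_comm (a b c : ℂ) : hypF a b c = hypF b a c := by
  ext x
  simp only [hypF, mul_comm (poch a _)]

lemma hypF_zero (a b c : ℂ) : hypF a b c 0 = 1 := by
  rw [hypF_eq_tsum, tsum_eq_single 0]
  · simp [hypCoeff]
  · intro n hn
    simp [hn]

lemma hypF_eq_ordinaryHypergeometric (a b c : ℂ) :
    hypF a b c = ordinaryHypergeometric (𝔸 := ℂ) a b c := by
  ext x
  rw [ordinaryHypergeometric_eq_tsum, hypF]
  refine tsum_congr fun n => ?_
  simp only [poch_eq_ascPochhammer, smul_eq_mul]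
  field_simp

lemma one_le_radius_ordinaryHypergeometricSeries (a b c : ℂ) :
    1 ≤ (ordinaryHypergeometricSeries ℂ a b c).radius := by
  by_cases h : ∀ n : ℕ, (n : ℂ) ≠ -a ∧ (n : ℂ) ≠ -b ∧ (n : ℂ) ≠ -c
  · exact (ordinaryHypergeometricSeries_radius_eq_one ℂ a b c h).ge
  · push Not at h
    obtain ⟨n, hn⟩ := h
    by_cases h1 : (n : ℂ) = -a
    · obtain rfl : a = -(n : ℂ) := by rw [h1, neg_neg]
      simp [ordinaryHypergeometric_radius_top_of_neg_nat₁]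
    by_cases h2 : (n : ℂ) = -b
    · obtain rfl : b = -(n : ℂ) := by rw [h2, neg_neg]
      simp [ordinaryHypergeometric_radius_top_of_neg_nat₂]
    obtain rfl : c = -(n : ℂ) := by rw [hn h1 h2, neg_neg]
    simp [ordinaryHypergeometric_radius_top_of_neg_nat₃]

lemma summable_norm_hypCoeff (a b c : ℂ) {r : ℝ} (h0 : 0 ≤ r) (hr : r < 1) :
    Summable fun n => ‖hypCoeff a b c n‖ * r ^ n := by
  have h := (ordinaryHypergeometricSeries ℂ a b c).summable_norm_mul_pow
    (r := ⟨r, h0⟩) (lt_of_lt_of_le (ENNReal.coe_lt_one_iff.2 hr)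
      (one_le_radius_ordinaryHypergeometricSeries a b c))
  refine h.congr fun n => ?_
  rw [ordinaryHypergeometricSeries, FormalMultilinearSeries.ofScalars_norm]
  simp only [hypCoeff, poch_eq_ascPochhammer]
  congr 2
  field_simp

lemma hasSum_hypF (a b c : ℂ) (hx : ‖x‖ < 1) :
    HasSum (fun n => hypCoeff a b c n * x ^ n) (hypF a b c x) := by
  refine Summable.hasSum (.of_norm ?_)
  simpa using summable_norm_hypCoeff a b c (norm_nonneg x) hx

lemma differentiableOn_hypF (a b c : ℂ) :
    DifferentiableOn ℂ (hypF a b c) (Metric.ball 0 1) := by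
  have h := ((ordinaryHypergeometricSeries ℂ a b c).hasFPowerSeriesOnBall
    (lt_of_lt_of_le one_pos (one_le_radius_ordinaryHypergeometricSeries a b c))).differentiableOn
  rw [hypF_eq_ordinaryHypergeometric]
  refine h.mono fun y hy => ?_
  refine Metric.eball_subset_eball (one_le_radius_ordinaryHypergeometricSeries a b c) ?_
  simpa [← ofReal_norm] using hy

lemma differentiableAt_hypF (a b c : ℂ) (hx : ‖x‖ < 1) : DifferentiableAt ℂ (hypF a b c) x :=
  (differentiableOn_hypF a b c).differentiableAt
    (Metric.isOpen_ball.mem_nhds (by simpa using hx))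

/-- The Euler operator `x d/dx` applied to the hypergeometric function. -/
noncomputable def thetaHypF (a b c x : ℂ) : ℂ := x * deriv (hypF a b c) x

lemma hasSum_thetaHypF (a b c : ℂ) (hx : ‖x‖ < 1) :
    HasSum (fun n => n * hypCoeff a b c n * x ^ n) (thetaHypF a b c x) := by
  obtain ⟨r, hxr, hr⟩ := exists_between hx
  have hr0 : 0 ≤ r := (norm_nonneg x).trans hxr.le
  have h := Complex.hasSum_deriv_of_summable_norm (U := Metric.ball (0 : ℂ) r) (z := x)
    (F := fun n y => hypCoeff a b c n * y ^ n)
    (summable_norm_hypCoeff a b c hr0 hr) (fun n => by fun_prop) Metric.isOpen_ball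
    (fun n y hy => by
      rw [norm_mul, norm_pow]
      have : ‖y‖ ≤ r := by simpa using (Metric.mem_ball.1 hy).le
      gcongr) (by simpa using hxr)
  refine HasSum.congr_fun (h.mul_left x) fun n => ?_
  rw [deriv_const_mul _ (by fun_prop)]
  cases n with
  | zero => simp
  | succ n => simp; ring

lemma differentiableAt_thetaHypF (a b c : ℂ) (hx : ‖x‖ < 1) :
    DifferentiableAt ℂ (thetaHypF a b c) x := by
  have h : DifferentiableOn ℂ (thetaHypF a b c) (Metric.ball 0 1) :=
    differentiableOn_id.mul ((differentiableOn_hypF a b c).deriv Metric.isOpen_ball)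
  exact h.differentiableAt (Metric.isOpen_ball.mem_nhds (by simpa using hx))

lemma thetaHypF_add_left (a b c : ℂ) (hx : ‖x‖ < 1) :
    thetaHypF a b c x + a * hypF a b c x = a * hypF (a + 1) b c x := by
  refine ((hasSum_thetaHypF a b c hx).add ((hasSum_hypF a b c hx).mul_left a)).unique ?_
  refine HasSum.congr_fun ((hasSum_hypF (a + 1) b c hx).mul_left a) fun n => ?_
  simp only [hypCoeff]
  linear_combination (-poch b n / (poch c n * (n.factorial : ℂ)) * x ^ n) * mul_poch_add_one a n

lemma thetaHypF_add_right (a b c : ℂ) (hx : ‖x‖ < 1) :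
    thetaHypF a b c x + b * hypF a b c x = b * hypF a (b + 1) c x := by
  have h := thetaHypF_add_left b a c hx
  rwa [thetaHypF, hypF_comm b a c, hypF_comm (b + 1) a c] at h

lemma thetaHypF_add_denom (a b : ℂ) (hc : ∀ n : ℕ, c ≠ -(n : ℂ)) (hx : ‖x‖ < 1) :
    thetaHypF a b (c + 1) x + c * hypF a b (c + 1) x = c * hypF a b c x := by
  refine ((hasSum_thetaHypF a b (c + 1) hx).add
    ((hasSum_hypF a b (c + 1) hx).mul_left c)).unique ?_
  refine HasSum.congr_fun ((hasSum_hypF a b c hx).mul_left c) fun n => ?_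
  have h1 := poch_ne_zero hc n
  have h2 := poch_ne_zero (add_one_ne_neg_natCast hc) n
  have h3 : (n.factorial : ℂ) ≠ 0 := by exact_mod_cast n.factorial_ne_zero
  simp only [hypCoeff]
  field_simp
  linear_combination (-poch a n * poch b n * x ^ n) * mul_poch_add_one c n

lemma thetaHypF_eq (a b : ℂ) (hc : ∀ n : ℕ, c ≠ -(n : ℂ)) (hx : ‖x‖ < 1) :
    thetaHypF a b c x = a * b / c * (x * hypF (a + 1) (b + 1) (c + 1) x) := by
  have h := hasSum_thetaHypF a b c hx
  rw [← hasSum_nat_add_iff' 1] at h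
  simp only [range_one, sum_singleton, Nat.cast_zero, zero_mul, sub_zero] at h
  refine h.unique ?_
  refine HasSum.congr_fun (((hasSum_hypF (a + 1) (b + 1) (c + 1) hx).mul_left x).mul_left
    (a * b / c)) fun n => ?_
  have h0 : c ≠ 0 := by simpa using hc 0
  have h2 := poch_ne_zero (add_one_ne_neg_natCast hc) n
  have h3 : (n.factorial : ℂ) ≠ 0 := by exact_mod_cast n.factorial_ne_zero
  have h4 : (n : ℂ) + 1 ≠ 0 := by exact_mod_cast n.succ_ne_zero
  simp only [hypCoeff, poch_succ_left, Nat.factorial_succ]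
  push_cast
  field_simp
  ring

lemma hypF_eq_add (a b : ℂ) (hc : ∀ n : ℕ, c ≠ -(n : ℂ)) (hx : ‖x‖ < 1) :
    hypF a b c x = hypF a b (c + 1) x +
      a * b / (c * (c + 1)) * (x * hypF (a + 1) (b + 1) (c + 1 + 1) x) := by
  have h1 := thetaHypF_add_denom a b hc hx
  rw [thetaHypF_eq a b (add_one_ne_neg_natCast hc) hx] at h1
  have h0 : c ≠ 0 := by simpa using hc 0
  have h2 : c + 1 ≠ 0 := by simpa using add_one_ne_neg_natCast hc 0
  field_simp at h1 ⊢
  linear_combination (-1 : ℂ) * h1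

/-- The hypergeometric differential equation in terms of the Euler operator. -/
lemma theta_thetaHypF (a b : ℂ) (hc : ∀ n : ℕ, c ≠ -(n : ℂ)) (hx : ‖x‖ < 1) :
    x * deriv (thetaHypF a b c) x + (c - 1) * thetaHypF a b c x =
      x * (x * deriv (thetaHypF a b c) x + (a + b) * thetaHypF a b c x + a * b * hypF a b c x) := by
  have h0 : c ≠ 0 := by simpa using hc 0
  have hmem : Metric.ball (0 : ℂ) 1 ∈ 𝓝 x := Metric.isOpen_ball.mem_nhds (by simpa using hx)
  have e1 : x * deriv (thetaHypF a b c) x =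
      a * b / c * x * (hypF (a + 1) (b + 1) (c + 1) x + thetaHypF (a + 1) (b + 1) (c + 1) x) := by
    have : thetaHypF a b c =ᶠ[𝓝 x]
        fun y => a * b / c * (y * hypF (a + 1) (b + 1) (c + 1) y) := by
      filter_upwards [hmem] with y hy
      exact thetaHypF_eq a b hc (by simpa using hy)
    have hd := differentiableAt_hypF (a + 1) (b + 1) (c + 1) hx
    rw [this.deriv_eq, deriv_const_mul _ (by fun_prop), deriv_fun_mul (by fun_prop) hd, thetaHypF]
    simp
    ring
  have e2 : x * deriv (thetaHypF a b c) x + a * thetaHypF a b c x =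
      a * (b * hypF (a + 1) (b + 1) c x - b * hypF (a + 1) b c x) := by
    have : thetaHypF a b c =ᶠ[𝓝 x] fun y => a * hypF (a + 1) b c y - a * hypF a b c y := by
      filter_upwards [hmem] with y hy
      rw [← thetaHypF_add_left a b c (by simpa using hy)]
      ring
    have hd := differentiableAt_hypF (a + 1) b c hx
    have hd' := differentiableAt_hypF a b c hx
    rw [this.deriv_eq, deriv_fun_sub (by fun_prop) (by fun_prop), deriv_const_mul _ hd,
      deriv_const_mul _ hd', ← thetaHypF_add_right (a + 1) b c hx]
    simp only [thetaHypF]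
    ring
  have e3 := thetaHypF_add_denom (a + 1) (b + 1) hc hx
  have e4 := thetaHypF_add_left a b c hx
  have e5 := thetaHypF_eq a b hc hx
  have e6 : x * deriv (thetaHypF a b c) x + (c - 1) * thetaHypF a b c x =
      x * (a * b * hypF (a + 1) (b + 1) c x) := by
    rw [e1, e5]
    field_simp
    linear_combination a * b * x * e3
  rw [e6]
  linear_combination (-x) * e2 - b * x * e4

end Series

section EulerIntegral

variable {a b c : ℂ}

/-- The strip `|Im ζ| < π`, which `ζ ↦ -exp ζ` maps onto the plane slit along `[0, ∞)`. -/
def expStrip : Set ℂ := {ζ | |ζ.im| < Real.pi}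

lemma isOpen_expStrip : IsOpen expStrip :=
  isOpen_lt (by fun_prop) continuous_const

lemma convex_expStrip : Convex ℝ expStrip := by
  have : expStrip = Complex.imLm ⁻¹' (Set.Ioo (-Real.pi) Real.pi) := by
    ext ζ
    simp [expStrip, abs_lt]
  rw [this]
  exact (convex_Ioo _ _).linear_preimage _

lemma ofReal_mem_expStrip (T : ℝ) : (T : ℂ) ∈ expStrip := by
  simp [expStrip, Real.pi_pos]

lemma norm_neg_exp_lt_one {ζ : ℂ} (h : ζ.re < 0) : ‖-Complex.exp ζ‖ < 1 := by
  rwa [norm_neg, Complex.norm_exp, Real.exp_lt_one_iff]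

/-- `g` is the analytic continuation of `ζ ↦ ₂F₁(a,b;c;-exp ζ)` to the strip `|Im ζ| < π`. -/
structure IsHypContinuation (a b c : ℂ) (g : ℂ → ℂ) : Prop where
  differentiableOn : DifferentiableOn ℂ g expStrip
  eq_hypF : ∀ ζ ∈ expStrip, ζ.re < 0 → g ζ = hypF a b c (-Complex.exp ζ)

lemma IsHypContinuation.differentiableAt {g : ℂ → ℂ} (hg : IsHypContinuation a b c g) {ζ : ℂ}
    (hζ : ζ ∈ expStrip) : DifferentiableAt ℂ g ζ :=
  hg.differentiableOn.differentiableAt (isOpen_expStrip.mem_nhds hζ)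

lemma eqOn_expStrip {g h : ℂ → ℂ} (hg : DifferentiableOn ℂ g expStrip)
    (hh : DifferentiableOn ℂ h expStrip) (heq : ∀ ζ ∈ expStrip, ζ.re < 0 → g ζ = h ζ) :
    Set.EqOn g h expStrip := by
  have hz : ((-1 : ℝ) : ℂ) ∈ expStrip := ofReal_mem_expStrip _
  refine (hg.analyticOnNhd isOpen_expStrip).eqOn_of_preconnected_of_eventuallyEq
    (hh.analyticOnNhd isOpen_expStrip) convex_expStrip.isPreconnected hz ?_
  have h1 : ∀ᶠ ζ : ℂ in 𝓝 ((-1 : ℝ) : ℂ), ζ.re < 0 :=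
    (Complex.continuous_re.isOpen_preimage _ isOpen_Iio).mem_nhds (by simp)
  filter_upwards [isOpen_expStrip.mem_nhds hz, h1] with ζ h2 h3 using heq ζ h2 h3

lemma one_add_exp_mul_mem_slitPlane {ζ : ℂ} (hζ : ζ ∈ expStrip) {t : ℝ} (ht : 0 ≤ t) :
    1 + Complex.exp ζ * t ∈ Complex.slitPlane := by
  rw [Complex.mem_slitPlane_iff]
  rcases ht.eq_or_lt with rfl | ht
  · simp
  by_cases h : Real.sin ζ.im = 0
  · have h' := abs_lt.1 (show |ζ.im| < Real.pi from hζ)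
    rw [Real.sin_eq_zero_iff_of_lt_of_lt h'.1 h'.2] at h
    left
    simp [Complex.exp_re, h]
    positivity
  · right
    simp [Complex.exp_im, h, ht.ne']

/-- The integrand of Euler's beta integral. -/
noncomputable def betaKernel (u v : ℂ) (t : ℝ) : ℂ := (t : ℂ) ^ (u - 1) * (1 - (t : ℂ)) ^ (v - 1)

lemma intervalIntegrable_betaKernel {u v : ℂ} (hu : 0 < u.re) (hv : 0 < v.re) :
    IntervalIntegrable (betaKernel u v) volume 0 1 :=
  Complex.betaIntegral_convergent hu hv

lemma betaKernel_mul_cpow {u v s : ℂ} {t : ℝ} (ht : 0 < t) :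
    betaKernel u v t * (t : ℂ) ^ s = betaKernel (u + s) v t := by
  have ht' : (t : ℂ) ≠ 0 := by exact_mod_cast ht.ne'
  rw [betaKernel, betaKernel, show u + s - 1 = (u - 1) + s by ring, Complex.cpow_add _ _ ht']
  ring

lemma differentiableOn_integral_mul_cpow (a : ℂ) {k : ℝ → ℂ}
    (hk : IntervalIntegrable k volume 0 1) :
    DifferentiableOn ℂ (fun ζ => ∫ t in (0 : ℝ)..1, k t * (1 + Complex.exp ζ * t) ^ (-a))
      expStrip := by
  intro ζ₀ hζ₀
  obtain ⟨ε, hε, hball⟩ := Metric.nhds_basis_closedBall.mem_iff.1 (isOpen_expStrip.mem_nhds hζ₀)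
  have hslit : ∀ p ∈ Metric.closedBall ζ₀ ε ×ˢ Set.Icc (0 : ℝ) 1,
      1 + Complex.exp p.1 * (p.2 : ℂ) ∈ Complex.slitPlane := fun p hp =>
    one_add_exp_mul_mem_slitPlane (hball hp.1) hp.2.1
  have hcont : ∀ s : ℂ, ContinuousOn (fun p : ℂ × ℝ => (1 + Complex.exp p.1 * (p.2 : ℂ)) ^ s)
      (Metric.closedBall ζ₀ ε ×ˢ Set.Icc (0 : ℝ) 1) := fun s =>
    ContinuousOn.cpow_const (by fun_prop) hslit
  have hcont' : ContinuousOn (fun p : ℂ × ℝ => (-a) * (1 + Complex.exp p.1 * (p.2 : ℂ)) ^ (-a - 1)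
      * (Complex.exp p.1 * (p.2 : ℂ))) (Metric.closedBall ζ₀ ε ×ˢ Set.Icc (0 : ℝ) 1) :=
    (continuousOn_const.mul (hcont _)).mul (by fun_prop)
  obtain ⟨C, hC⟩ := ((isCompact_closedBall ζ₀ ε).prod isCompact_Icc).exists_bound_of_continuousOn
    hcont'
  have hsec : ∀ ζ ∈ Metric.closedBall ζ₀ ε, ∀ {f : ℂ × ℝ → ℂ},
      ContinuousOn f (Metric.closedBall ζ₀ ε ×ˢ Set.Icc (0 : ℝ) 1) →
      IntervalIntegrable (fun t => k t * f (ζ, t)) volume 0 1 := fun ζ hζ f hf => by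
    refine hk.mul_continuousOn (hf.comp (by fun_prop) fun t ht => ⟨hζ, ?_⟩)
    rwa [Set.uIcc_of_le zero_le_one] at ht
  have h₀ := Metric.mem_closedBall_self (x := ζ₀) hε.le
  have key := intervalIntegral.hasDerivAt_integral_of_dominated_loc_of_deriv_le
    (F := fun ζ (t : ℝ) => k t * (1 + Complex.exp ζ * t) ^ (-a))
    (F' := fun ζ (t : ℝ) => k t * ((-a) * (1 + Complex.exp ζ * (t : ℂ)) ^ (-a - 1)
      * (Complex.exp ζ * (t : ℂ))))
    (bound := fun t => ‖k t‖ * C) (μ := volume) (a := 0) (b := 1)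
    (Metric.closedBall_mem_nhds ζ₀ hε) ?_ (hsec ζ₀ h₀ (hcont (-a)))
    (hsec ζ₀ h₀ hcont').aestronglyMeasurable_restrict_uIoc ?_ (hk.norm.mul_const C) ?_
  · exact key.2.differentiableAt.differentiableWithinAt
  · filter_upwards [Metric.closedBall_mem_nhds ζ₀ hε] with ζ hζ using
      (hsec ζ hζ (hcont (-a))).aestronglyMeasurable_restrict_uIoc
  · refine ae_of_all _ fun t ht ζ hζ => ?_
    rw [Set.uIoc_of_le zero_le_one] at ht
    rw [norm_mul]
    exact mul_le_mul_of_nonneg_left (hC (ζ, t) ⟨hζ, ht.1.le, ht.2⟩) (norm_nonneg _)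
  · refine ae_of_all _ fun t ht ζ hζ => ?_
    rw [Set.uIoc_of_le zero_le_one] at ht
    exact ((((Complex.hasDerivAt_exp ζ).mul_const (t : ℂ)).const_add 1).cpow_const
      (hslit (ζ, t) ⟨hζ, ht.1.le, ht.2⟩)).const_mul (k t)

lemma Gamma_add_natCast (hb : ∀ n : ℕ, b ≠ -(n : ℂ)) (n : ℕ) :
    Complex.Gamma (b + n) = poch b n * Complex.Gamma b := by
  induction n with
  | zero => simp
  | succ n ih =>
    have : b + n ≠ 0 := fun h => hb n (eq_neg_of_add_eq_zero_left h)
    rw [poch_succ, Nat.cast_succ, ← add_assoc, Complex.Gamma_add_one _ this, ih]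
    ring

lemma ne_neg_natCast_of_re_pos (hb : 0 < b.re) (n : ℕ) : b ≠ -(n : ℂ) := by
  rintro rfl
  simp only [Complex.neg_re, Complex.natCast_re, Left.neg_pos_iff] at hb
  exact hb.not_ge n.cast_nonneg

lemma betaIntegral_eq_div {u v : ℂ} (hu : 0 < u.re) (hv : 0 < v.re) :
    Complex.betaIntegral u v =
      Complex.Gamma u * Complex.Gamma v / Complex.Gamma (u + v) := by
  rw [Complex.Gamma_mul_Gamma_eq_betaIntegral hu hv, mul_div_cancel_left₀]
  exact Complex.Gamma_ne_zero_of_re_pos (by simpa using add_pos hu hv)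

lemma betaIntegral_add_natCast {v : ℂ} (hb : 0 < b.re) (hv : 0 < v.re) (n : ℕ) :
    Complex.betaIntegral (b + n) v =
      poch b n / poch (b + v) n * Complex.betaIntegral b v := by
  have hbv : 0 < (b + v).re := by simpa using add_pos hb hv
  have hbn : 0 < (b + n).re := by
    rw [Complex.add_re, Complex.natCast_re]
    exact add_pos_of_pos_of_nonneg hb n.cast_nonneg
  rw [betaIntegral_eq_div hbn hv, betaIntegral_eq_div hb hv, show b + n + v = b + v + n by ring,
    Gamma_add_natCast (ne_neg_natCast_of_re_pos hb),
    Gamma_add_natCast (ne_neg_natCast_of_re_pos hbv)]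
  field_simp

lemma hasSum_one_sub_cpow_neg (a : ℂ) {y : ℂ} (hy : ‖y‖ < 1) :
    HasSum (fun n => hypCoeff a 1 1 n * y ^ n) ((1 - y) ^ (-a)) := by
  have h := (Complex.one_add_cpow_hasFPowerSeriesOnBall_zero (a := -a)).hasSum (y := -y)
    (by simpa [← ofReal_norm] using hy)
  rw [binomialSeries_eq_ordinaryHypergeometricSeries (b := (1 : ℂ))
    (fun k hk => by
      have : ((k + 1 : ℕ) : ℂ) = 0 := by push_cast; linear_combination hk
      exact absurd (by exact_mod_cast this) k.succ_ne_zero)] at h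
  rw [zero_add, neg_neg, ← sub_eq_add_neg] at h
  refine h.congr_fun fun n => ?_
  have : (fun _ : Fin n => y) = (-(ContinuousLinearMap.id ℂ ℂ)) ∘ fun _ : Fin n => -y := by
    ext; simp
  rw [FormalMultilinearSeries.compContinuousLinearMap_apply, ← this,
    ordinaryHypergeometricSeries_apply_eq]
  simp only [hypCoeff, poch_eq_ascPochhammer, smul_eq_mul]
  field_simp

lemma integral_betaKernel_mul_cpow (a : ℂ) (hb : 0 < b.re) (hbc : b.re < c.re) {x : ℂ}
    (hx : ‖x‖ < 1) :
    ∫ t in (0 : ℝ)..1, betaKernel b (c - b) t * (1 - x * t) ^ (-a) =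
      Complex.betaIntegral b (c - b) * hypF a b c x := by
  have hcb : 0 < (c - b).re := by simpa using hbc
  have hk := intervalIntegrable_betaKernel hb hcb
  have hsum := summable_norm_hypCoeff a 1 1 (norm_nonneg x) hx
  have hbd : ∀ (n : ℕ) (t : ℝ), t ∈ Set.Ioc (0 : ℝ) 1 → ‖hypCoeff a 1 1 n * (x * t) ^ n‖ ≤
      ‖hypCoeff a 1 1 n‖ * ‖x‖ ^ n := by
    intro n t ht
    rw [norm_mul, norm_pow, norm_mul, Complex.norm_real, Real.norm_of_nonneg ht.1.le]
    have := mul_le_of_le_one_right (norm_nonneg x) ht.2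
    have := mul_nonneg (norm_nonneg x) ht.1.le
    gcongr
  have hxt : ∀ t ∈ Set.Ioc (0 : ℝ) 1, ‖x * t‖ < 1 := by
    intro t ht
    rw [norm_mul, Complex.norm_real, Real.norm_of_nonneg ht.1.le]
    exact (mul_le_of_le_one_right (norm_nonneg x) ht.2).trans_lt hx
  have key := intervalIntegral.hasSum_integral_of_dominated_convergence (μ := volume)
    (a := 0) (b := 1)
    (F := fun n (t : ℝ) => betaKernel b (c - b) t * (hypCoeff a 1 1 n * (x * t) ^ n))
    (f := fun t : ℝ => betaKernel b (c - b) t * (1 - x * t) ^ (-a))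
    (fun n t => ‖betaKernel b (c - b) t‖ * (‖hypCoeff a 1 1 n‖ * ‖x‖ ^ n))
    (fun n => (hk.mul_continuousOn (by fun_prop)).aestronglyMeasurable_restrict_uIoc)
    (fun n => ae_of_all _ fun t ht => by
      rw [Set.uIoc_of_le zero_le_one] at ht
      rw [norm_mul]
      exact mul_le_mul_of_nonneg_left (hbd n t ht) (norm_nonneg _))
    (ae_of_all _ fun t _ => hsum.mul_left _)
    (by simpa only [tsum_mul_left] using hk.norm.mul_const _)
    (ae_of_all _ fun t ht => by
      rw [Set.uIoc_of_le zero_le_one] at ht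
      exact (hasSum_one_sub_cpow_neg a (hxt t ht)).mul_left _)
  refine key.unique (HasSum.congr_fun ((hasSum_hypF a b c hx).mul_left _) fun n => ?_)
  have h1 : ∫ t in (0 : ℝ)..1, betaKernel b (c - b) t * (hypCoeff a 1 1 n * (x * t) ^ n) =
      ∫ t in (0 : ℝ)..1, hypCoeff a 1 1 n * x ^ n * betaKernel (b + n) (c - b) t := by
    refine intervalIntegral.integral_congr_ae (ae_of_all _ fun t ht => ?_)
    rw [Set.uIoc_of_le zero_le_one] at ht
    rw [← betaKernel_mul_cpow ht.1, Complex.cpow_natCast]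
    ring
  rw [h1, intervalIntegral.integral_const_mul,
    show ∫ t in (0 : ℝ)..1, betaKernel (b + n) (c - b) t = Complex.betaIntegral (b + n) (c - b)
      from rfl, betaIntegral_add_natCast hb hcb, add_sub_cancel]
  have h2 : poch 1 n ≠ 0 := poch_ne_zero (ne_neg_natCast_of_re_pos (by simp)) n
  have h3 : poch c n ≠ 0 := poch_ne_zero (ne_neg_natCast_of_re_pos (hb.trans hbc)) n
  simp only [hypCoeff]
  field_simp

lemma exp_mul_one_add_exp_mul_cpow (a : ℂ) (T : ℝ) {t : ℝ} (ht : 0 < t) :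
    Complex.exp (a * T) * (1 + Complex.exp T * t) ^ (-a) =
      ((Real.exp (-T) + t : ℝ) : ℂ) ^ (-a) := by
  have h : 1 + Complex.exp T * t = (Real.exp T : ℂ) * ((Real.exp (-T) + t : ℝ) : ℂ) := by
    have : Complex.exp T * Complex.exp (-T) = 1 := by rw [← Complex.exp_add]; simp
    push_cast
    linear_combination -this
  rw [h, Complex.mul_cpow_ofReal_nonneg (Real.exp_pos T).le (by positivity), ← mul_assoc,
    Complex.cpow_def_of_ne_zero (by exact_mod_cast (Real.exp_pos T).ne'),
    ← Complex.ofReal_log (Real.exp_pos T).le, Real.log_exp, ← Complex.exp_add]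
  simp [mul_comm]

lemma norm_add_cpow_neg_le (a : ℂ) {s t : ℝ} (hs : 0 ≤ s) (hs1 : s ≤ 1) (ht : 0 < t)
    (ht1 : t ≤ 1) :
    ‖((s + t : ℝ) : ℂ) ^ (-a)‖ ≤ ‖(t : ℂ) ^ (-a)‖ + 2 ^ (-a.re) := by
  rw [Complex.norm_cpow_eq_rpow_re_of_pos (by positivity),
    Complex.norm_cpow_eq_rpow_re_of_pos ht, Complex.neg_re]
  rcases le_total 0 a.re with h | h
  · have := Real.rpow_le_rpow_of_nonpos ht (by linarith : t ≤ s + t) (by linarith : -a.re ≤ 0)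
    have : (0 : ℝ) ≤ 2 ^ (-a.re) := by positivity
    linarith
  · have := Real.rpow_le_rpow (by positivity) (by linarith : s + t ≤ 2) (by linarith : 0 ≤ -a.re)
    have : (0 : ℝ) ≤ t ^ (-a.re) := by positivity
    linarith

lemma tendsto_exp_mul_integral_betaKernel (hb : 0 < b.re) (hbc : b.re < c.re)
    (hab : a.re < b.re) :
    Tendsto (fun T : ℝ => Complex.exp (a * T) *
        ∫ t in (0 : ℝ)..1, betaKernel b (c - b) t * (1 + Complex.exp T * t) ^ (-a))
      atTop (𝓝 (Complex.betaIntegral (b - a) (c - b))) := by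
  have hcb : 0 < (c - b).re := by simpa using hbc
  have hba : 0 < (b - a).re := by simpa using hab
  have hk := intervalIntegrable_betaKernel hb hcb
  have hk' := intervalIntegrable_betaKernel hba hcb
  simp only [← intervalIntegral.integral_const_mul]
  refine intervalIntegral.tendsto_integral_filter_of_dominated_convergence
    (fun t => ‖betaKernel (b - a) (c - b) t‖ + ‖betaKernel b (c - b) t‖ * 2 ^ (-a.re))
    (Eventually.of_forall fun T => ?_) ?_ (hk'.norm.add (hk.norm.mul_const _))
    (ae_of_all _ fun t ht => ?_)
  · refine IntervalIntegrable.aestronglyMeasurable_restrict_uIoc (.const_mul ?_ _)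
    refine hk.mul_continuousOn (ContinuousOn.cpow_const (by fun_prop) fun t ht => ?_)
    rw [Set.uIcc_of_le zero_le_one] at ht
    exact one_add_exp_mul_mem_slitPlane (ofReal_mem_expStrip T) ht.1
  · filter_upwards [eventually_ge_atTop 0] with T hT
    refine ae_of_all _ fun t ht => ?_
    rw [Set.uIoc_of_le zero_le_one] at ht
    rw [mul_left_comm, exp_mul_one_add_exp_mul_cpow a T ht.1, norm_mul, sub_eq_add_neg b a,
      ← betaKernel_mul_cpow ht.1, norm_mul, ← mul_add]
    exact mul_le_mul_of_nonneg_left (norm_add_cpow_neg_le a (Real.exp_pos _).le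
      (Real.exp_le_one_iff.2 (by linarith)) ht.1 ht.2) (norm_nonneg _)
  · rw [Set.uIoc_of_le zero_le_one] at ht
    have h : Tendsto (fun T : ℝ => ((Real.exp (-T) + t : ℝ) : ℂ) ^ (-a)) atTop
        (𝓝 (((0 + t : ℝ) : ℂ) ^ (-a))) := by
      refine ((Complex.continuous_ofReal.tendsto _).comp
        ((Real.tendsto_exp_neg_atTop_nhds_zero).add_const t)).cpow tendsto_const_nhds ?_
      simp [ht.1]
    rw [zero_add] at h
    have h2 := h.const_mul (betaKernel b (c - b) t)
    rw [betaKernel_mul_cpow ht.1, ← sub_eq_add_neg] at h2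
    refine h2.congr fun T => ?_
    rw [mul_left_comm, exp_mul_one_add_exp_mul_cpow a T ht.1]

lemma exists_isHypContinuation_of_re_lt (hb : 0 < b.re) (hbc : b.re < c.re) (hab : a.re < b.re) :
    ∃ g, IsHypContinuation a b c g ∧
      Tendsto (fun T : ℝ => Complex.exp (a * T) * g T) atTop
        (𝓝 (Complex.Gamma c * Complex.Gamma (b - a) /
          (Complex.Gamma b * Complex.Gamma (c - a)))) := by
  have hcb : 0 < (c - b).re := by simpa using hbc
  have hba : 0 < (b - a).re := by simpa using hab
  have hk := intervalIntegrable_betaKernel hb hcb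
  have hΓb := Complex.Gamma_ne_zero_of_re_pos hb
  have hΓc := Complex.Gamma_ne_zero_of_re_pos (hb.trans hbc)
  have hΓcb := Complex.Gamma_ne_zero_of_re_pos hcb
  have hΓca : Complex.Gamma (c - a) ≠ 0 :=
    Complex.Gamma_ne_zero_of_re_pos (by rw [Complex.sub_re]; linarith)
  have hB : Complex.betaIntegral b (c - b) ≠ 0 := by
    rw [betaIntegral_eq_div hb hcb, add_sub_cancel]
    positivity
  refine ⟨fun ζ => (Complex.betaIntegral b (c - b))⁻¹ * ∫ t in (0 : ℝ)..1,
    betaKernel b (c - b) t * (1 + Complex.exp ζ * t) ^ (-a),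
    ⟨(differentiableOn_integral_mul_cpow a hk).const_mul _, fun ζ _ hre => ?_⟩, ?_⟩
  · have h := integral_betaKernel_mul_cpow a hb hbc (norm_neg_exp_lt_one hre)
    simp only [neg_mul, sub_neg_eq_add] at h
    rw [h, inv_mul_cancel_left₀ hB]
  · convert! (tendsto_exp_mul_integral_betaKernel hb hbc hab).const_mul
      (Complex.betaIntegral b (c - b))⁻¹ using 2
    · ring
    · rw [betaIntegral_eq_div hb hcb, betaIntegral_eq_div hba hcb, add_sub_cancel,
        show b - a + (c - b) = c - a by ring]
      field_simp

/-- The analytic continuation and its leading coefficient at infinity, without a lower bound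
on `Re c`. -/
lemma exists_isHypContinuation (hc : ∀ n : ℕ, c ≠ -(n : ℂ)) (hb : 0 < b.re) (hab : a.re < b.re) :
    ∃ g, IsHypContinuation a b c g ∧
      Tendsto (fun T : ℝ => Complex.exp (a * T) * g T) atTop
        (𝓝 (Complex.Gamma c * Complex.Gamma (b - a) /
          (Complex.Gamma b * Complex.Gamma (c - a)))) := by
  obtain ⟨m, hm⟩ := exists_nat_gt (b.re - c.re)
  induction m generalizing a b c with
  | zero => exact exists_isHypContinuation_of_re_lt hb (by simpa using hm) hab
  | succ m ih =>
    have hc1 := add_one_ne_neg_natCast hc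
    have hc0 : c ≠ 0 := by simpa using hc 0
    have hc10 : c + 1 ≠ 0 := by simpa using hc1 0
    have hb0 : b ≠ 0 := by simpa using ne_neg_natCast_of_re_pos hb 0
    push_cast at hm
    obtain ⟨g₁, h₁, l₁⟩ := ih (c := c + 1) hc1 hb hab (by simp; linarith)
    obtain ⟨g₂, h₂, l₂⟩ := ih (a := a + 1) (b := b + 1) (c := c + 1 + 1)
      (add_one_ne_neg_natCast hc1) (by simp; linarith) (by simpa using hab) (by simp; linarith)
    refine ⟨fun ζ => g₁ ζ + a * b / (c * (c + 1)) * (-Complex.exp ζ * g₂ ζ), ⟨?_, ?_⟩, ?_⟩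
    · exact h₁.differentiableOn.add
        (((by fun_prop : DifferentiableOn ℂ (fun ζ => -Complex.exp ζ) expStrip).mul
          h₂.differentiableOn).const_mul _)
    · intro ζ hζ hre
      rw [hypF_eq_add a b hc (norm_neg_exp_lt_one hre), h₁.eq_hypF ζ hζ hre,
        h₂.eq_hypF ζ hζ hre]
    · convert! l₁.add (l₂.const_mul (-(a * b / (c * (c + 1))))) using 2 with T
      · rw [add_one_mul, Complex.exp_add]
        ring
      · have h3 := Complex.one_div_Gamma_eq_self_mul_one_div_Gamma_add_one (c - a)
        rw [show b + 1 - (a + 1) = b - a by ring, show c + 1 + 1 - (a + 1) = c - a + 1 by ring,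
          show c + 1 - a = c - a + 1 by ring, Complex.Gamma_add_one _ hc10,
          Complex.Gamma_add_one _ hc0, Complex.Gamma_add_one _ hb0, div_eq_mul_inv, mul_inv, h3]
        have hΓb := Complex.Gamma_ne_zero_of_re_pos hb
        field_simp
        ring

end EulerIntegral

section DifferentialEquation

variable {a b c ζ : ℂ}

/-- The hypergeometric differential equation at `ζ`, in the variable `ζ = log (-w)`. -/
def SatisfiesHypODE (a b c : ℂ) (g : ℂ → ℂ) (ζ : ℂ) : Prop :=
  deriv (deriv g) ζ + (c - 1) * deriv g ζ =
    -Complex.exp ζ * (deriv (deriv g) ζ + (a + b) * deriv g ζ + a * b * g ζ)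

lemma isOpen_re_lt_zero : IsOpen {ζ : ℂ | ζ.re < 0} :=
  isOpen_lt Complex.continuous_re continuous_const

lemma IsHypContinuation.symm {g : ℂ → ℂ} (hg : IsHypContinuation a b c g) :
    IsHypContinuation b a c g :=
  ⟨hg.differentiableOn, by rw [hypF_comm]; exact hg.eq_hypF⟩

lemma IsHypContinuation.differentiableOn_deriv {g : ℂ → ℂ} (hg : IsHypContinuation a b c g) :
    DifferentiableOn ℂ (deriv g) expStrip :=
  hg.differentiableOn.deriv isOpen_expStrip

lemma hasDerivAt_neg_exp (ζ : ℂ) :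
    HasDerivAt (fun ζ => -Complex.exp ζ) (-Complex.exp ζ) ζ :=
  (Complex.hasDerivAt_exp ζ).neg

lemma IsHypContinuation.deriv_eq {g : ℂ → ℂ} (hg : IsHypContinuation a b c g)
    (hζ : ζ ∈ expStrip) (hre : ζ.re < 0) : deriv g ζ = thetaHypF a b c (-Complex.exp ζ) := by
  have h : g =ᶠ[𝓝 ζ] fun ζ => hypF a b c (-Complex.exp ζ) := by
    filter_upwards [isOpen_expStrip.mem_nhds hζ, isOpen_re_lt_zero.mem_nhds hre] with ξ h1 h2
      using hg.eq_hypF ξ h1 h2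
  have h' := (differentiableAt_hypF a b c (norm_neg_exp_lt_one hre)).hasDerivAt.comp ζ
    (hasDerivAt_neg_exp ζ)
  rw [h.deriv_eq, thetaHypF, mul_comm]
  exact h'.deriv

lemma IsHypContinuation.deriv_deriv_eq {g : ℂ → ℂ} (hg : IsHypContinuation a b c g)
    (hζ : ζ ∈ expStrip) (hre : ζ.re < 0) :
    deriv (deriv g) ζ = -Complex.exp ζ * deriv (thetaHypF a b c) (-Complex.exp ζ) := by
  have h : deriv g =ᶠ[𝓝 ζ] fun ζ => thetaHypF a b c (-Complex.exp ζ) := by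
    filter_upwards [isOpen_expStrip.mem_nhds hζ, isOpen_re_lt_zero.mem_nhds hre] with ξ h1 h2
      using hg.deriv_eq h1 h2
  have h' := (differentiableAt_thetaHypF a b c (norm_neg_exp_lt_one hre)).hasDerivAt.comp ζ
    (hasDerivAt_neg_exp ζ)
  rw [h.deriv_eq, mul_comm]
  exact h'.deriv

lemma IsHypContinuation.satisfiesHypODE (hc : ∀ n : ℕ, c ≠ -(n : ℂ)) {g : ℂ → ℂ}
    (hg : IsHypContinuation a b c g) (hζ : ζ ∈ expStrip) : SatisfiesHypODE a b c g ζ := by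
  have h0 := hg.differentiableOn
  have h1 := hg.differentiableOn_deriv
  have h2 := h1.deriv isOpen_expStrip
  refine eqOn_expStrip (h2.add (h1.const_mul _)) (DifferentiableOn.mul
    (by fun_prop : DifferentiableOn ℂ (fun ζ => -Complex.exp ζ) expStrip)
    ((h2.add (h1.const_mul _)).add (h0.const_mul _))) (fun ξ hξ hre => ?_) hζ
  simp only [Pi.add_apply, Pi.mul_apply]
  rw [hg.deriv_deriv_eq hξ hre, hg.deriv_eq hξ hre, hg.eq_hypF ξ hξ hre]
  exact theta_thetaHypF a b hc (norm_neg_exp_lt_one hre)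

lemma IsHypContinuation.raise_right (hb : b ≠ 0) {g : ℂ → ℂ} (hg : IsHypContinuation a b c g) :
    IsHypContinuation a (b + 1) c fun ζ => (deriv g ζ + b * g ζ) / b := by
  refine ⟨(hg.differentiableOn_deriv.add (hg.differentiableOn.const_mul b)).div_const b,
    fun ζ hζ hre => ?_⟩
  rw [hg.deriv_eq hζ hre, hg.eq_hypF ζ hζ hre,
    thetaHypF_add_right a b c (norm_neg_exp_lt_one hre), mul_div_cancel_left₀ _ hb]

/-- The solution `(-w)^(-a) ₂F₁(a,1-c+a;1-b+a;1/w)` at infinity, in the variable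
`ζ = log (-w)`. -/
noncomputable def solAtInfty (a b c ζ : ℂ) : ℂ :=
  Complex.exp (-a * ζ) * hypF a (1 - c + a) (1 - b + a) (-Complex.exp (-ζ))

lemma norm_neg_exp_neg_lt_one (h : 0 < ζ.re) : ‖-Complex.exp (-ζ)‖ < 1 :=
  norm_neg_exp_lt_one (by simpa using h)

lemma hasDerivAt_neg_exp_neg (ζ : ℂ) :
    HasDerivAt (fun ζ => -Complex.exp (-ζ)) (Complex.exp (-ζ)) ζ :=
  (hasDerivAt_neg ζ).cexp.neg.congr_deriv (by simp)

lemma hasDerivAt_exp_neg_mul (a ζ : ℂ) :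
    HasDerivAt (fun ζ => Complex.exp (-a * ζ)) (-a * Complex.exp (-a * ζ)) ζ := by
  simpa [mul_comm] using ((hasDerivAt_id ζ).const_mul (-a)).cexp

lemma hasDerivAt_solAtInfty (a b c : ℂ) (hre : 0 < ζ.re) :
    HasDerivAt (solAtInfty a b c) (-Complex.exp (-a * ζ) *
      (thetaHypF a (1 - c + a) (1 - b + a) (-Complex.exp (-ζ)) +
        a * hypF a (1 - c + a) (1 - b + a) (-Complex.exp (-ζ)))) ζ := by
  have h := (hasDerivAt_exp_neg_mul a ζ).mul
    ((differentiableAt_hypF a (1 - c + a) (1 - b + a)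
      (norm_neg_exp_neg_lt_one hre)).hasDerivAt.comp ζ (hasDerivAt_neg_exp_neg ζ))
  refine h.congr_deriv ?_
  simp only [thetaHypF, Function.comp_apply]
  ring

lemma isOpen_re_gt (R : ℝ) : IsOpen {ζ : ℂ | R < ζ.re} :=
  isOpen_lt continuous_const Complex.continuous_re

lemma deriv_deriv_solAtInfty (a b c : ℂ) (hre : 0 < ζ.re) :
    deriv (deriv (solAtInfty a b c)) ζ = Complex.exp (-a * ζ) *
      (-Complex.exp (-ζ) * deriv (thetaHypF a (1 - c + a) (1 - b + a)) (-Complex.exp (-ζ)) +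
        2 * a * thetaHypF a (1 - c + a) (1 - b + a) (-Complex.exp (-ζ)) +
        a ^ 2 * hypF a (1 - c + a) (1 - b + a) (-Complex.exp (-ζ))) := by
  have h : deriv (solAtInfty a b c) =ᶠ[𝓝 ζ] fun ζ => -Complex.exp (-a * ζ) *
      (thetaHypF a (1 - c + a) (1 - b + a) (-Complex.exp (-ζ)) +
        a * hypF a (1 - c + a) (1 - b + a) (-Complex.exp (-ζ))) := by
    filter_upwards [(isOpen_re_gt 0).mem_nhds hre] with ξ hξ
      using (hasDerivAt_solAtInfty a b c hξ).deriv
  have hy := norm_neg_exp_neg_lt_one hre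
  have h1 := (differentiableAt_hypF a (1 - c + a) (1 - b + a) hy).hasDerivAt.comp ζ
    (hasDerivAt_neg_exp_neg ζ)
  have h2 := (differentiableAt_thetaHypF a (1 - c + a) (1 - b + a) hy).hasDerivAt.comp ζ
    (hasDerivAt_neg_exp_neg ζ)
  have h3 := (hasDerivAt_exp_neg_mul a ζ).neg.mul (h2.add (h1.const_mul a))
  rw [h.deriv_eq]
  refine (HasDerivAt.congr_deriv h3 ?_).deriv
  simp only [thetaHypF, Function.comp_apply, Pi.add_apply, Pi.neg_apply]
  ring

lemma one_sub_add_ne_neg_natCast (hab : ∀ n : ℤ, a - b ≠ n) (n : ℕ) :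
    1 - b + a ≠ -(n : ℂ) := by
  intro h
  apply hab (-n - 1)
  push_cast
  linear_combination h

lemma sub_ne_intCast_symm (hab : ∀ n : ℤ, a - b ≠ n) (n : ℤ) : b - a ≠ n := by
  intro h
  apply hab (-n)
  push_cast
  linear_combination -h

lemma satisfiesHypODE_solAtInfty (hab : ∀ n : ℤ, a - b ≠ n) (hre : 0 < ζ.re) :
    SatisfiesHypODE a b c (solAtInfty a b c) ζ := by
  have h := theta_thetaHypF a (1 - c + a) (one_sub_add_ne_neg_natCast hab)
    (norm_neg_exp_neg_lt_one hre)
  rw [SatisfiesHypODE, deriv_deriv_solAtInfty a b c hre, (hasDerivAt_solAtInfty a b c hre).deriv,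
    solAtInfty]
  have he : Complex.exp ζ * Complex.exp (-ζ) = 1 := by rw [← Complex.exp_add]; simp
  generalize Complex.exp (-ζ) = y at *
  generalize thetaHypF a (1 - c + a) (1 - b + a) (-y) = Θ at *
  generalize hypF a (1 - c + a) (1 - b + a) (-y) = Φ at *
  generalize deriv (thetaHypF a (1 - c + a) (1 - b + a)) (-y) = Θ' at *
  have hy : y ≠ 0 := right_ne_zero_of_mul (he.trans_ne one_ne_zero)
  refine mul_left_cancel₀ hy ?_
  linear_combination Complex.exp (-a * ζ) * h +
    Complex.exp (-a * ζ) * (-y * Θ' + (a - b) * Θ) * he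

lemma SatisfiesHypODE.symm {g : ℂ → ℂ} (h : SatisfiesHypODE a b c g ζ) :
    SatisfiesHypODE b a c g ζ := by
  unfold SatisfiesHypODE at *
  linear_combination h

lemma differentiableOn_solAtInfty (a b c : ℂ) :
    DifferentiableOn ℂ (solAtInfty a b c) {ζ | 0 < ζ.re} := fun _ hζ =>
  (hasDerivAt_solAtInfty a b c hζ).differentiableAt.differentiableWithinAt

lemma deriv_solAtInfty_add_right (hab : ∀ n : ℤ, a - b ≠ n) (hre : 0 < ζ.re) :
    deriv (solAtInfty a b c) ζ + b * solAtInfty a b c ζ =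
      (b - a) * solAtInfty a (b + 1) c ζ := by
  have h := thetaHypF_add_denom (c := a - b) a (1 - c + a) (fun n h => hab (-n) (by simpa using h))
    (norm_neg_exp_neg_lt_one hre)
  rw [(hasDerivAt_solAtInfty a b c hre).deriv, solAtInfty, solAtInfty,
    show 1 - (b + 1) + a = a - b by ring, show 1 - b + a = a - b + 1 by ring]
  linear_combination (-Complex.exp (-a * ζ)) * h

lemma deriv_solAtInfty_add_left (hab : ∀ n : ℤ, a - b ≠ n) (hre : 0 < ζ.re) :
    deriv (solAtInfty a b c) ζ + a * solAtInfty a b c ζ =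
      a * (1 - c + a) / (1 - b + a) * solAtInfty (a + 1) b c ζ := by
  have h := thetaHypF_eq a (1 - c + a) (one_sub_add_ne_neg_natCast hab)
    (norm_neg_exp_neg_lt_one hre)
  rw [(hasDerivAt_solAtInfty a b c hre).deriv, h, solAtInfty, solAtInfty, ← add_assoc, ← add_assoc,
    show -(a + 1) * ζ = -a * ζ + -ζ by ring, Complex.exp_add]
  ring

lemma tendsto_neg_exp_neg :
    Tendsto (fun ζ : ℂ => -Complex.exp (-ζ)) (comap Complex.re atTop) (𝓝 0) := by
  rw [tendsto_zero_iff_norm_tendsto_zero]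
  simp only [norm_neg, Complex.norm_exp, Complex.neg_re]
  exact Real.tendsto_exp_neg_atTop_nhds_zero.comp tendsto_comap

lemma tendsto_ofReal_comap_re : Tendsto (fun T : ℝ => (T : ℂ)) atTop (comap Complex.re atTop) := by
  rw [tendsto_comap_iff]
  exact tendsto_id

lemma continuousAt_hypF_zero (a b c : ℂ) : ContinuousAt (hypF a b c) 0 :=
  (differentiableAt_hypF a b c (by simp)).continuousAt

lemma tendsto_exp_mul_solAtInfty (a b c : ℂ) :
    Tendsto (fun T : ℝ => Complex.exp (a * T) * solAtInfty a b c T) atTop (𝓝 1) := by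
  have h := (continuousAt_hypF_zero a (1 - c + a) (1 - b + a)).tendsto.comp
    (tendsto_neg_exp_neg.comp tendsto_ofReal_comap_re)
  rw [hypF_zero] at h
  refine h.congr fun T => ?_
  rw [solAtInfty, ← mul_assoc, ← Complex.exp_add]
  simp

lemma tendsto_exp_mul_solAtInfty_zero (c : ℂ) (hab : a.re < b.re) :
    Tendsto (fun T : ℝ => Complex.exp (a * T) * solAtInfty b a c T) atTop (𝓝 0) := by
  have h : Tendsto (fun T : ℝ => Complex.exp ((a - b) * T)) atTop (𝓝 0) := by
    rw [tendsto_zero_iff_norm_tendsto_zero]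
    simp only [Complex.norm_exp, Complex.re_mul_ofReal, Complex.sub_re]
    exact Real.tendsto_exp_atBot.comp
      ((tendsto_const_mul_atBot_of_neg (by linarith)).2 tendsto_id)
  have h2 := h.mul (tendsto_exp_mul_solAtInfty b a c)
  rw [zero_mul] at h2
  refine h2.congr fun T => ?_
  rw [← mul_assoc, ← Complex.exp_add]
  ring_nf

/-- The Wronskian of two functions. -/
noncomputable def wronskian (u v : ℂ → ℂ) (ζ : ℂ) : ℂ := u ζ * deriv v ζ - deriv u ζ * v ζ

lemma exists_wronskian_solAtInfty_ne_zero (hab : a ≠ b) (c : ℂ) :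
    ∃ R : ℝ, 0 ≤ R ∧ ∀ ζ : ℂ, R < ζ.re →
      wronskian (solAtInfty a b c) (solAtInfty b a c) ζ ≠ 0 := by
  have hθ : ∀ a b c : ℂ, ContinuousAt (thetaHypF a b c) 0 := fun a b c =>
    (differentiableAt_thetaHypF a b c (by simp)).continuousAt
  have hF := continuousAt_hypF_zero
  set Φ := hypF a (1 - c + a) (1 - b + a) with hΦ
  set Ψ := hypF b (1 - c + b) (1 - a + b) with hΨ
  set Φ' := thetaHypF a (1 - c + a) (1 - b + a) with hΦ'
  set Ψ' := thetaHypF b (1 - c + b) (1 - a + b) with hΨ'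
  have hcont : ContinuousAt (fun y => (Φ' y + a * Φ y) * Ψ y - Φ y * (Ψ' y + b * Ψ y)) 0 :=
    (((hθ _ _ _).add (continuousAt_const.mul (hF _ _ _))).mul (hF _ _ _)).sub
      ((hF _ _ _).mul ((hθ _ _ _).add (continuousAt_const.mul (hF _ _ _))))
  have hne : (Φ' 0 + a * Φ 0) * Ψ 0 - Φ 0 * (Ψ' 0 + b * Ψ 0) ≠ 0 := by
    simpa [hΦ, hΨ, hΦ', hΨ', hypF_zero, thetaHypF, sub_eq_zero] using hab
  have hev := tendsto_neg_exp_neg.eventually (hcont.eventually_ne hne)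
  rw [eventually_comap, eventually_atTop] at hev
  obtain ⟨R, hR⟩ := hev
  refine ⟨max R 0, le_max_right _ _, fun ζ hζ => ?_⟩
  have h1 := hR ζ.re ((le_max_left _ _).trans hζ.le) ζ rfl
  have hre : 0 < ζ.re := (le_max_right _ _).trans_lt hζ
  have h2 : wronskian (solAtInfty a b c) (solAtInfty b a c) ζ =
      Complex.exp (-a * ζ) * Complex.exp (-b * ζ) *
        ((Φ' (-Complex.exp (-ζ)) + a * Φ (-Complex.exp (-ζ))) * Ψ (-Complex.exp (-ζ)) -
          Φ (-Complex.exp (-ζ)) * (Ψ' (-Complex.exp (-ζ)) + b * Ψ (-Complex.exp (-ζ)))) := by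
    rw [wronskian, (hasDerivAt_solAtInfty a b c hre).deriv,
      (hasDerivAt_solAtInfty b a c hre).deriv, solAtInfty, solAtInfty]
    ring
  rw [h2]
  exact mul_ne_zero (mul_ne_zero (Complex.exp_ne_zero _) (Complex.exp_ne_zero _)) h1

lemma hasDerivAt_wronskian {s : Set ℂ} (hs : IsOpen s) {u v : ℂ → ℂ}
    (hu : DifferentiableOn ℂ u s) (hv : DifferentiableOn ℂ v s) (hζ : ζ ∈ s) :
    HasDerivAt (wronskian u v) (u ζ * deriv (deriv v) ζ - deriv (deriv u) ζ * v ζ) ζ := by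
  have hd := fun {f : ℂ → ℂ} (hf : DifferentiableOn ℂ f s) =>
    (hf.differentiableAt (hs.mem_nhds hζ)).hasDerivAt
  refine (((hd hu).mul (hd (hv.deriv hs))).sub ((hd (hu.deriv hs)).mul (hd hv))).congr_deriv ?_
  ring

lemma exists_wronskian_eq_mul {s : Set ℂ} (hs : IsOpen s) (hs' : IsPreconnected s)
    (hexp : ∀ ζ ∈ s, 1 + Complex.exp ζ ≠ 0) {u v p q : ℂ → ℂ}
    (hu : DifferentiableOn ℂ u s) (hv : DifferentiableOn ℂ v s)
    (hp : DifferentiableOn ℂ p s) (hq : DifferentiableOn ℂ q s)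
    (eu : ∀ ζ ∈ s, SatisfiesHypODE a b c u ζ) (ev : ∀ ζ ∈ s, SatisfiesHypODE a b c v ζ)
    (ep : ∀ ζ ∈ s, SatisfiesHypODE a b c p ζ) (eq : ∀ ζ ∈ s, SatisfiesHypODE a b c q ζ)
    (hW : ∀ ζ ∈ s, wronskian p q ζ ≠ 0) :
    ∃ A : ℂ, ∀ ζ ∈ s, wronskian u v ζ = A * wronskian p q ζ := by
  have hd : ∀ ζ ∈ s, HasDerivAt (fun ζ => wronskian u v ζ / wronskian p q ζ) 0 ζ := by
    intro ζ hζ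
    refine ((hasDerivAt_wronskian hs hu hv hζ).div (hasDerivAt_wronskian hs hp hq hζ)
      (hW ζ hζ)).congr_deriv ?_
    rw [div_eq_zero_iff]
    left
    refine mul_left_cancel₀ (hexp ζ hζ) ?_
    have h1 := eu ζ hζ
    have h2 := ev ζ hζ
    have h3 := ep ζ hζ
    have h4 := eq ζ hζ
    simp only [SatisfiesHypODE, wronskian] at *
    linear_combination (p ζ * deriv q ζ - deriv p ζ * q ζ) * (u ζ * h2 - v ζ * h1) -
      (u ζ * deriv v ζ - deriv u ζ * v ζ) * (p ζ * h4 - q ζ * h3)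
  obtain ⟨A, hA⟩ := hs.exists_is_const_of_deriv_eq_zero hs'
    (fun ζ hζ => (hd ζ hζ).differentiableAt.differentiableWithinAt) fun ζ hζ => (hd ζ hζ).deriv
  exact ⟨A, fun ζ hζ => by rw [← hA ζ hζ, div_mul_cancel₀ _ (hW ζ hζ)]⟩

lemma IsHypContinuation.exists_eq_add (hc : ∀ n : ℕ, c ≠ -(n : ℂ)) (hab : ∀ n : ℤ, a - b ≠ n)
    {g : ℂ → ℂ} (hg : IsHypContinuation a b c g) :
    ∃ A B : ℂ, ∀ ζ ∈ expStrip, 0 < ζ.re →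
      g ζ = A * solAtInfty a b c ζ + B * solAtInfty b a c ζ := by
  have hba := sub_ne_intCast_symm hab
  obtain ⟨R, hR0, hR⟩ := exists_wronskian_solAtInfty_ne_zero
    (a := a) (b := b) (fun h => hab 0 (by simp [h])) c
  have hopen : ∀ r : ℝ, IsOpen (expStrip ∩ {ζ | r < ζ.re}) := fun r =>
    isOpen_expStrip.inter (isOpen_re_gt r)
  have hconn : ∀ r : ℝ, IsPreconnected (expStrip ∩ {ζ | r < ζ.re}) := fun r =>
    (convex_expStrip.inter (convex_halfSpace_re_gt r)).isPreconnected
  have hsol : ∀ (a b : ℂ) {r : ℝ}, 0 ≤ r →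
      DifferentiableOn ℂ (solAtInfty a b c) (expStrip ∩ {ζ | r < ζ.re}) := fun a b r hr =>
    (differentiableOn_solAtInfty a b c).mono fun ζ hζ => hr.trans_lt hζ.2
  have hgd : ∀ r : ℝ, DifferentiableOn ℂ g (expStrip ∩ {ζ | r < ζ.re}) := fun r =>
    hg.differentiableOn.mono Set.inter_subset_left
  have eg : ∀ ζ ∈ expStrip ∩ {ζ | R < ζ.re}, SatisfiesHypODE a b c g ζ := fun ζ hζ =>
    hg.satisfiesHypODE hc hζ.1
  have e1 : ∀ ζ ∈ expStrip ∩ {ζ | R < ζ.re}, SatisfiesHypODE a b c (solAtInfty a b c) ζ :=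
    fun ζ hζ => satisfiesHypODE_solAtInfty hab (hR0.trans_lt hζ.2)
  have e2 : ∀ ζ ∈ expStrip ∩ {ζ | R < ζ.re}, SatisfiesHypODE a b c (solAtInfty b a c) ζ :=
    fun ζ hζ => (satisfiesHypODE_solAtInfty hba (hR0.trans_lt hζ.2)).symm
  have hexp : ∀ ζ ∈ expStrip ∩ {ζ | R < ζ.re}, 1 + Complex.exp ζ ≠ 0 := fun ζ hζ => by
    simpa using Complex.slitPlane_ne_zero (one_add_exp_mul_mem_slitPlane hζ.1 zero_le_one)
  obtain ⟨A, hA⟩ := exists_wronskian_eq_mul (hopen R) (hconn R) hexp (hgd R) (hsol b a hR0)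
    (hsol a b hR0) (hsol b a hR0) eg e2 e1 e2 fun ζ hζ => hR ζ hζ.2
  obtain ⟨B, hB⟩ := exists_wronskian_eq_mul (hopen R) (hconn R) hexp (hsol a b hR0) (hgd R)
    (hsol a b hR0) (hsol b a hR0) e1 eg e1 e2 fun ζ hζ => hR ζ hζ.2
  have hfar : ∀ ζ ∈ expStrip ∩ {ζ | R < ζ.re},
      g ζ = A * solAtInfty a b c ζ + B * solAtInfty b a c ζ := by
    intro ζ hζ
    refine mul_right_cancel₀ (hR ζ hζ.2) ?_
    have h1 := hA ζ hζ
    have h2 := hB ζ hζ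
    simp only [wronskian] at *
    linear_combination solAtInfty a b c ζ * h1 + solAtInfty b a c ζ * h2
  refine ⟨A, B, fun ζ hζ hre => ?_⟩
  have hz : ((R + 1 : ℝ) : ℂ) ∈ expStrip ∩ {ζ | R < ζ.re} :=
    ⟨ofReal_mem_expStrip _, by simp⟩
  have hz' : ((R + 1 : ℝ) : ℂ) ∈ expStrip ∩ {ζ | 0 < ζ.re} :=
    ⟨ofReal_mem_expStrip _, by simpa using by linarith⟩
  refine ((hgd 0).analyticOnNhd (hopen 0)).eqOn_of_preconnected_of_eventuallyEq
    (g := fun ζ => A * solAtInfty a b c ζ + B * solAtInfty b a c ζ)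
    ((((hsol a b le_rfl).const_mul A).add ((hsol b a le_rfl).const_mul B)).analyticOnNhd (hopen 0))
    (hconn 0) hz' ?_ ⟨hζ, hre⟩
  filter_upwards [(hopen R).mem_nhds hz] with ξ hξ using hfar ξ hξ

end DifferentialEquation

section ConnectionCoefficients

variable {a b c : ℂ}

lemma IsHypContinuation.leadingCoeff_eq (hc : ∀ n : ℕ, c ≠ -(n : ℂ)) (hab : ∀ n : ℤ, a - b ≠ n)
    (hb : ∀ n : ℕ, b ≠ -(n : ℂ)) {g : ℂ → ℂ} (hg : IsHypContinuation a b c g) {A B : ℂ}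
    (heq : ∀ ζ ∈ expStrip, 0 < ζ.re →
      g ζ = A * solAtInfty a b c ζ + B * solAtInfty b a c ζ) :
    A = Complex.Gamma c * Complex.Gamma (b - a) /
      (Complex.Gamma b * Complex.Gamma (c - a)) := by
  obtain ⟨m, hm⟩ := exists_nat_gt (max (-b.re) (a.re - b.re))
  rw [max_lt_iff] at hm
  induction m generalizing b g A B with
  | zero =>
    simp only [Nat.cast_zero, Left.neg_neg_iff, sub_neg] at hm
    obtain ⟨h, hh, hlim⟩ := exists_isHypContinuation (a := a) hc hm.1 hm.2
    refine tendsto_nhds_unique ?_ hlim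
    have h1 := ((tendsto_exp_mul_solAtInfty a b c).const_mul A).add
      ((tendsto_exp_mul_solAtInfty_zero c hm.2).const_mul B)
    rw [mul_one, mul_zero, add_zero] at h1
    refine h1.congr' ?_
    filter_upwards [eventually_gt_atTop 0] with T hT
    have hT' := ofReal_mem_expStrip T
    rw [← eqOn_expStrip hg.differentiableOn hh.differentiableOn (fun ζ hζ hre =>
      (hg.eq_hypF ζ hζ hre).trans (hh.eq_hypF ζ hζ hre).symm) hT', heq T hT' (by simpa using hT)]
    ring
  | succ m ih =>
    have hb0 : b ≠ 0 := by simpa using hb 0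
    have hba := sub_ne_intCast_symm hab
    have hba0 : b - a ≠ 0 := by simpa using hba 0
    push_cast at hm
    have h := ih (b := b + 1) (A := A * (b - a) / b)
      (B := B * (b * (1 - c + b) / (1 - a + b)) / b)
      (fun n h => hab (n + 1) (by push_cast; linear_combination h))
      (add_one_ne_neg_natCast hb) (hg.raise_right hb0) (fun ζ hζ hre => ?_)
      (by simp only [Complex.add_re, Complex.one_re]; constructor <;> linarith [hm.1, hm.2])
    · rw [show b + 1 - a = b - a + 1 by ring, Complex.Gamma_add_one _ hba0,
        Complex.Gamma_add_one _ hb0] at h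
      have h2 : (b - a) / b ≠ 0 := div_ne_zero hba0 hb0
      refine mul_right_cancel₀ h2 ?_
      rw [← mul_div_assoc, h]
      simp only [div_eq_mul_inv, mul_inv]
      ring
    · have hev : g =ᶠ[𝓝 ζ] fun ζ => A * solAtInfty a b c ζ + B * solAtInfty b a c ζ := by
        filter_upwards [isOpen_expStrip.mem_nhds hζ, (isOpen_re_gt 0).mem_nhds hre] with ξ h1 h2
          using heq ξ h1 h2
      have d1 := (hasDerivAt_solAtInfty a b c hre).differentiableAt
      have d2 := (hasDerivAt_solAtInfty b a c hre).differentiableAt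
      have e1 := deriv_solAtInfty_add_right (c := c) hab hre
      have e2 := deriv_solAtInfty_add_left (c := c) hba hre
      rw [hev.deriv_eq, heq ζ hζ hre, deriv_fun_add (d1.const_mul A) (d2.const_mul B),
        deriv_const_mul _ d1, deriv_const_mul _ d2]
      linear_combination A / b * e1 + B / b * e2

lemma neg_exp_ne_ofReal {ζ : ℂ} (hζ : ζ ∈ expStrip) {r : ℝ} (hr : 0 < r) :
    -Complex.exp ζ ≠ r := by
  intro h
  have h1 := one_add_exp_mul_mem_slitPlane hζ (inv_pos.2 hr).le
  have hr' : (r : ℂ) ≠ 0 := by exact_mod_cast hr.ne'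
  rw [neg_eq_iff_eq_neg.1 h] at h1
  simp [hr'] at h1

end ConnectionCoefficients

/-- Connection formula for the analytic continuation of the Gauss hypergeometric
function to `|w| > 1`. -/
theorem gauss_connection_formula (a b c : ℂ)
    (hab : ∀ n : ℤ, a - b ≠ (n : ℂ))
    (ha : ∀ n : ℕ, a ≠ -(n : ℂ)) (hb : ∀ n : ℕ, b ≠ -(n : ℂ))
    (hc : ∀ n : ℕ, c ≠ -(n : ℂ))
    (F : ℂ → ℂ)
    (hF : AnalyticOn ℂ F {w : ℂ | ∀ r : ℝ, 1 ≤ r → w ≠ (r : ℂ)})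
    (hFeq : ∀ w : ℂ, ‖w‖ < 1 → F w = hypF a b c w)
    (w : ℂ) (hw : 1 < ‖w‖) (hwpos : ∀ r : ℝ, 0 < r → w ≠ (r : ℂ)) :
    F w / Complex.Gamma c =
      Complex.Gamma (b - a) / (Complex.Gamma b * Complex.Gamma (c - a)) *
          (-w) ^ (-a) * hypF a (1 - c + a) (1 - b + a) (1 / w) +
        Complex.Gamma (a - b) / (Complex.Gamma a * Complex.Gamma (c - b)) *
          (-w) ^ (-b) * hypF b (1 - c + b) (1 - a + b) (1 / w) := by
  have hg : IsHypContinuation a b c fun ζ => F (-Complex.exp ζ) := by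
    refine ⟨hF.differentiableOn.comp (by fun_prop) fun ζ hζ r hr => ?_, fun ζ _ hre => ?_⟩
    · exact neg_exp_ne_ofReal hζ (zero_lt_one.trans_le hr)
    · exact hFeq _ (norm_neg_exp_lt_one hre)
  obtain ⟨A, B, h⟩ := hg.exists_eq_add hc hab
  have hA := hg.leadingCoeff_eq hc hab hb h
  have hB := hg.symm.leadingCoeff_eq hc (sub_ne_intCast_symm hab) ha
    fun ζ hζ hre => (h ζ hζ hre).trans (add_comm _ _)
  have hw0 : -w ≠ 0 := by
    rw [neg_ne_zero, ← norm_pos_iff]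
    exact one_pos.trans hw
  have hmem : Complex.log (-w) ∈ expStrip := by
    rw [expStrip, Set.mem_ofPred_eq, Complex.log_im]
    refine lt_of_le_of_ne (Complex.abs_arg_le_pi _) fun habs => ?_
    have harg : Complex.arg (-w) = Real.pi := by
      rcases abs_eq_abs.1 (habs.trans (abs_of_pos Real.pi_pos).symm) with h | h
      · exact h
      · exact absurd h (Complex.neg_pi_lt_arg _).ne'
    rw [Complex.arg_eq_pi_iff] at harg
    simp only [Complex.neg_re, Left.neg_neg_iff, Complex.neg_im, neg_eq_zero] at harg
    exact hwpos w.re harg.1 (Complex.ext rfl (by simpa using harg.2))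
  have hre : 0 < (Complex.log (-w)).re := by
    rw [Complex.log_re, norm_neg]
    exact Real.log_pos hw
  have key := h _ hmem hre
  have hΓ := Complex.Gamma_ne_zero hc
  simp only [solAtInfty, Complex.exp_neg, Complex.exp_log hw0, neg_neg] at key
  rw [key, hA, hB, Complex.cpow_def_of_ne_zero hw0, Complex.cpow_def_of_ne_zero hw0,
    show -(-w)⁻¹ = 1 / w by rw [inv_neg, neg_neg, one_div], mul_comm _ (-a), mul_comm _ (-b),
    add_div]
  field_simp
end

section
/- Let −1 < Re z < 0, −1 < Re z' < 0. Define M(x,y) = t ∫∫_{t_1,t_2 > 0} φ_{−z}(t_1)φ_{−z'}(t_2)φ_{z'}(t_1+1)φ_z(t_2+1) e^{−x(t_1+1/2)−y(t_2+1/2)}/(t_1+t_2+1) dt_1 dt_2, where t = zz'. Then (x−y)M(x,y) = [e^{−(x+y)/2}/(Γ(z)Γ(z'))] · ( ∫_0^∞ φ_{−z−1}(t_1)(t_1+1)^{z'} e^{−x t_1} dt_1 · ∫_0^∞ φ_{−z'}(t_2)(t_2+1)^{z−1} e^{−y t_2} dt_2 − ∫_0^∞ φ_{−z}(t_1)(t_1+1)^{z'−1}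 e^{−x t_1} dt_1 · ∫_0^∞ φ_{−z'−1}(t_2)(t_2+1)^{z} e^{−y t_2} dt_2 ) for all x, y > 0. -/
open MeasureTheory

/-- The function `φ_a(u) = u₊^a / Γ(a+1)`. -/
noncomputable def phi (a : ℂ) (u : ℝ) : ℂ :=
  if 0 < u then (u : ℂ) ^ a / Complex.Gamma (a + 1) else 0

/-- The kernel `t ^ a * (t + 1) ^ b * exp (-x t)` of Tricomi's integral for the Whittaker function. -/
noncomputable def tricomiKernel (a b : ℂ) (x t : ℝ) : ℂ :=
  (t : ℂ) ^ a * ((t + 1 : ℝ) : ℂ) ^ b * (Real.exp (-x * t) : ℂ)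

/-- The derivative of `tricomiKernel a b x`. -/
noncomputable def tricomiKernelDeriv (a b : ℂ) (x t : ℝ) : ℂ :=
  a * tricomiKernel (a - 1) b x t + b * tricomiKernel a (b - 1) x t - x * tricomiKernel a b x t

lemma measurable_tricomiKernel (a b : ℂ) (x : ℝ) : Measurable (tricomiKernel a b x) := by
  unfold tricomiKernel
  fun_prop

lemma integrableOn_tricomiKernel {a b : ℂ} {x : ℝ} (ha : -1 < a.re) (hb : b.re ≤ 0) (hx : 0 < x) :
    IntegrableOn (tricomiKernel a b x) (Set.Ioi 0) := by
  have h := integrableOn_rpow_mul_exp_neg_mul_rpow ha one_pos hx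
  refine Integrable.mono' h (measurable_tricomiKernel a b x).aestronglyMeasurable ?_
  refine (ae_restrict_iff' measurableSet_Ioi).2 (.of_forall fun t (ht : 0 < t) => ?_)
  have ht1 : 0 < t + 1 := by linarith
  have h1 : (t + 1) ^ b.re ≤ 1 := Real.rpow_le_one_of_one_le_of_nonpos (by linarith) hb
  rw [tricomiKernel, norm_mul, norm_mul, Complex.norm_cpow_eq_rpow_re_of_pos ht,
    Complex.norm_cpow_eq_rpow_re_of_pos ht1, Complex.norm_real, Real.norm_of_nonneg (by positivity),
    Real.rpow_one]
  gcongr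
  exact mul_le_of_le_one_right (by positivity) h1

lemma integrableOn_tricomiKernelDeriv {a b : ℂ} {x : ℝ} (ha : 0 < a.re) (hb : b.re ≤ 0)
    (hx : 0 < x) : IntegrableOn (tricomiKernelDeriv a b x) (Set.Ioi 0) := by
  have ha' : -1 < (a - 1).re := by simp; linarith
  have hb' : (b - 1).re ≤ 0 := by simp; linarith
  exact (((integrableOn_tricomiKernel ha' hb hx).const_mul a).add
    ((integrableOn_tricomiKernel (by linarith) hb' hx).const_mul b)).sub
    ((integrableOn_tricomiKernel (by linarith) hb hx).const_mul (x : ℂ))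

lemma hasDerivAt_tricomiKernel {a : ℂ} (ha : a ≠ 0) (b : ℂ) (x : ℝ) {t : ℝ} (ht : 0 < t) :
    HasDerivAt (tricomiKernel a b x) (tricomiKernelDeriv a b x t) t := by
  have h1 : HasDerivAt (fun s : ℝ => (s : ℂ) ^ a) (a * (t : ℂ) ^ (a - 1)) t :=
    hasDerivAt_ofReal_cpow_const ht.ne' ha
  have h2 : HasDerivAt (fun s : ℝ => ((s + 1 : ℝ) : ℂ) ^ b)
      (b * ((t + 1 : ℝ) : ℂ) ^ (b - 1)) t := by
    have h : HasDerivAt (fun s : ℝ => ((s + 1 : ℝ) : ℂ)) ((1 : ℝ) : ℂ) t :=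
      ((hasDerivAt_id t).add_const 1).ofReal_comp
    have hs : ((t + 1 : ℝ) : ℂ) ∈ Complex.slitPlane :=
      Complex.ofReal_mem_slitPlane.2 (by linarith)
    simpa [Function.comp_def] using ((hasDerivAt_id ((t + 1 : ℝ) : ℂ)).cpow_const (c := b) hs).scomp t h
  have h3 : HasDerivAt (fun s : ℝ => (Real.exp (-x * s) : ℂ))
      ((Real.exp (-x * t) * (-x) : ℝ) : ℂ) t := by
    have h := ((hasDerivAt_id t).const_mul (-x)).exp
    simp only [id, mul_one] at h
    exact h.ofReal_comp
  refine ((h1.mul h2).mul h3).congr_deriv ?_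
  simp only [tricomiKernelDeriv, tricomiKernel, Pi.mul_apply]
  push_cast
  ring

lemma norm_inv_ofReal_le_one {s : ℝ} (hs : 1 ≤ s) : ‖((s : ℂ))⁻¹‖ ≤ 1 := by
  rw [norm_inv, Complex.norm_real, Real.norm_of_nonneg (by linarith)]
  exact inv_le_one_of_one_le₀ hs

lemma integral_deriv_tricomiKernel_div {a b : ℂ} {x c : ℝ} (ha : 0 < a.re) (hb : b.re ≤ 0)
    (hx : 0 < x) (hc : 1 ≤ c) :
    ∫ t in Set.Ioi (0 : ℝ), (tricomiKernelDeriv a b x t * ((t + c : ℝ) : ℂ)⁻¹ -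
      tricomiKernel a b x t * (((t + c : ℝ) : ℂ)⁻¹) ^ 2) = 0 := by
  have ha0 : a ≠ 0 := fun h => by simp [h] at ha
  have hK := integrableOn_tricomiKernel (a := a) (b := b) (by linarith) hb hx
  have hw : AEStronglyMeasurable (fun t : ℝ => ((t + c : ℝ) : ℂ)⁻¹)
      (volume.restrict (Set.Ioi 0)) := by
    apply Measurable.aestronglyMeasurable; fun_prop
  have hw1 : ∀ᵐ t ∂(volume.restrict (Set.Ioi (0 : ℝ))), ‖((t + c : ℝ) : ℂ)⁻¹‖ ≤ 1 :=
    (ae_restrict_iff' measurableSet_Ioi).2 (.of_forall fun t (ht : 0 < t) =>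
      norm_inv_ofReal_le_one (by linarith))
  have hw2 : ∀ᵐ t ∂(volume.restrict (Set.Ioi (0 : ℝ))), ‖(((t + c : ℝ) : ℂ)⁻¹) ^ 2‖ ≤ 1 := by
    filter_upwards [hw1] with t ht
    rw [norm_pow]
    exact pow_le_one₀ (norm_nonneg _) ht
  have hderiv : ∀ t ∈ Set.Ioi (0 : ℝ), HasDerivAt
      (fun t : ℝ => tricomiKernel a b x t * ((t + c : ℝ) : ℂ)⁻¹)
      (tricomiKernelDeriv a b x t * ((t + c : ℝ) : ℂ)⁻¹ -
        tricomiKernel a b x t * (((t + c : ℝ) : ℂ)⁻¹) ^ 2) t := by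
    intro t (ht : 0 < t)
    have hne : ((t + c : ℝ) : ℂ) ≠ 0 := by
      exact_mod_cast (by linarith : 0 < t + c).ne'
    have h : HasDerivAt (fun s : ℝ => ((s + c : ℝ) : ℂ)) ((1 : ℝ) : ℂ) t :=
      ((hasDerivAt_id t).add_const c).ofReal_comp
    refine ((hasDerivAt_tricomiKernel ha0 b x ht).mul (h.fun_inv hne)).congr_deriv ?_
    simp only [Complex.ofReal_one]
    field_simp
    ring
  have hint : IntegrableOn (fun t : ℝ => tricomiKernelDeriv a b x t * ((t + c : ℝ) : ℂ)⁻¹ -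
      tricomiKernel a b x t * (((t + c : ℝ) : ℂ)⁻¹) ^ 2) (Set.Ioi 0) :=
    ((integrableOn_tricomiKernelDeriv ha hb hx).mul_bdd hw hw1).sub
      (hK.mul_bdd (hw.pow 2) hw2)
  have hcont : ContinuousWithinAt (fun t : ℝ => tricomiKernel a b x t * ((t + c : ℝ) : ℂ)⁻¹)
      (Set.Ici 0) 0 := by
    apply ContinuousAt.continuousWithinAt
    have h1 : ContinuousAt (fun s : ℝ => (s : ℂ) ^ a) 0 :=
      Complex.continuousAt_ofReal_cpow_const 0 a (.inl ha)
    have h2 : ContinuousAt (fun s : ℝ => ((s + 1 : ℝ) : ℂ) ^ b) 0 := by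
      refine ContinuousAt.cpow (by fun_prop) (by fun_prop) ?_
      exact Complex.ofReal_mem_slitPlane.2 (by linarith)
    have h3 : ContinuousAt (fun s : ℝ => (Real.exp (-x * s) : ℂ)) 0 := by fun_prop
    have h4 : ContinuousAt (fun s : ℝ => ((s + c : ℝ) : ℂ)⁻¹) 0 := by
      refine ContinuousAt.inv₀ (by fun_prop) ?_
      exact_mod_cast (by linarith : 0 < 0 + c).ne'
    exact ((h1.mul h2).mul h3).mul h4
  rw [integral_Ioi_of_hasDerivAt_of_tendsto hcont hderiv hint
    (tendsto_zero_of_hasDerivAt_of_integrableOn_Ioi hderiv hint (hK.mul_bdd hw hw1))]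
  simp [tricomiKernel, ha0]

/-- The derivative in `p.1` of `tricomiKernel a b x p.1 * v p.2 / (p.1 + p.2 + 1)`. -/
noncomputable def tricomiKernelFlux (a b : ℂ) (x : ℝ) (v : ℝ → ℂ) (p : ℝ × ℝ) : ℂ :=
  (tricomiKernelDeriv a b x p.1 * v p.2) * ((p.1 + (p.2 + 1) : ℝ) : ℂ)⁻¹ -
    (tricomiKernel a b x p.1 * v p.2) * (((p.1 + (p.2 + 1) : ℝ) : ℂ)⁻¹) ^ 2

lemma ae_norm_inv_add_le_one :
    ∀ᵐ p : ℝ × ℝ ∂((volume.restrict (Set.Ioi 0)).prod (volume.restrict (Set.Ioi 0))),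
      ‖((p.1 + (p.2 + 1) : ℝ) : ℂ)⁻¹‖ ≤ 1 := by
  rw [Measure.prod_restrict]
  refine (ae_restrict_iff' (measurableSet_Ioi.prod measurableSet_Ioi)).2 (.of_forall ?_)
  rintro ⟨s, t⟩ ⟨hs, ht⟩
  simp only [Set.mem_Ioi] at hs ht
  exact norm_inv_ofReal_le_one (by linarith)

lemma aestronglyMeasurable_inv_add (μ : Measure (ℝ × ℝ)) :
    AEStronglyMeasurable (fun p : ℝ × ℝ => ((p.1 + (p.2 + 1) : ℝ) : ℂ)⁻¹) μ := by
  apply Measurable.aestronglyMeasurable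
  fun_prop

lemma integrable_mul_inv_add {u v : ℝ → ℂ} (hu : IntegrableOn u (Set.Ioi 0))
    (hv : IntegrableOn v (Set.Ioi 0)) :
    Integrable (fun p : ℝ × ℝ => (u p.1 * v p.2) * ((p.1 + (p.2 + 1) : ℝ) : ℂ)⁻¹)
      ((volume.restrict (Set.Ioi 0)).prod (volume.restrict (Set.Ioi 0))) :=
  (Integrable.mul_prod hu hv).mul_bdd (aestronglyMeasurable_inv_add _) ae_norm_inv_add_le_one

lemma integrable_tricomiKernelFlux {a b : ℂ} {x : ℝ} {v : ℝ → ℂ} (ha : 0 < a.re) (hb : b.re ≤ 0)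
    (hx : 0 < x) (hv : IntegrableOn v (Set.Ioi 0)) :
    Integrable (tricomiKernelFlux a b x v)
      ((volume.restrict (Set.Ioi 0)).prod (volume.restrict (Set.Ioi 0))) := by
  refine (integrable_mul_inv_add (integrableOn_tricomiKernelDeriv ha hb hx) hv).sub
    ((Integrable.mul_prod (integrableOn_tricomiKernel (by linarith) hb hx) hv).mul_bdd (c := 1)
      ((aestronglyMeasurable_inv_add _).pow 2) ?_)
  filter_upwards [ae_norm_inv_add_le_one] with p hp
  simp only [norm_pow]
  exact pow_le_one₀ (norm_nonneg _) hp

lemma integral_tricomiKernelFlux {a b : ℂ} {x : ℝ} {v : ℝ → ℂ} (ha : 0 < a.re) (hb : b.re ≤ 0)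
    (hx : 0 < x) (hv : IntegrableOn v (Set.Ioi 0)) :
    ∫ p, tricomiKernelFlux a b x v p
      ∂((volume.restrict (Set.Ioi 0)).prod (volume.restrict (Set.Ioi 0))) = 0 := by
  rw [integral_prod_symm _ (integrable_tricomiKernelFlux ha hb hx hv)]
  refine setIntegral_eq_zero_of_forall_eq_zero fun t (ht : 0 < t) => ?_
  have h := integral_deriv_tricomiKernel_div ha hb hx (c := t + 1) (by linarith)
  have h' := congrArg (· * v t) h
  simp only [← integral_mul_const, zero_mul] at h'
  refine (integral_congr_ae (.of_forall fun s => ?_)).trans h'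
  simp only [tricomiKernelFlux]
  ring

lemma tricomiKernel_sub_one_left (a b : ℂ) (x : ℝ) {t : ℝ} (ht : 0 < t) :
    tricomiKernel (a - 1) b x t = tricomiKernel a b x t / t := by
  have h : (t : ℂ) ≠ 0 := by exact_mod_cast ht.ne'
  rw [tricomiKernel, tricomiKernel, Complex.cpow_sub _ _ h, Complex.cpow_one]
  ring

lemma tricomiKernel_sub_one_right (a b : ℂ) (x : ℝ) {t : ℝ} (ht : 0 < t) :
    tricomiKernel a (b - 1) x t = tricomiKernel a b x t / (t + 1) := by
  have h : ((t + 1 : ℝ) : ℂ) ≠ 0 := by exact_mod_cast (by linarith : 0 < t + 1).ne'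
  rw [tricomiKernel, tricomiKernel, Complex.cpow_sub _ _ h, Complex.cpow_one]
  push_cast
  ring

lemma tricomiKernelFlux_sub_swap (z z' : ℂ) (x y : ℝ) {s t : ℝ} (hs : 0 < s) (ht : 0 < t) :
    tricomiKernelFlux (-z) z' x (tricomiKernel (-z') z y) (s, t) -
        tricomiKernelFlux (-z') z y (tricomiKernel (-z) z' x) (t, s) =
      -z * (tricomiKernel (-z - 1) z' x s * tricomiKernel (-z') (z - 1) y t) +
        z' * (tricomiKernel (-z) (z' - 1) x s * tricomiKernel (-z' - 1) z y t) -
        (x - y) * (tricomiKernel (-z) z' x s * tricomiKernel (-z') z y t *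
          ((s + (t + 1) : ℝ) : ℂ)⁻¹) := by
  have h1 : (s : ℂ) ≠ 0 := by exact_mod_cast hs.ne'
  have h2 : (t : ℂ) ≠ 0 := by exact_mod_cast ht.ne'
  have h3 : (s : ℂ) + 1 ≠ 0 := by exact_mod_cast (by linarith : 0 < s + 1).ne'
  have h4 : (t : ℂ) + 1 ≠ 0 := by exact_mod_cast (by linarith : 0 < t + 1).ne'
  have h5 : (s : ℂ) + (t + 1) ≠ 0 := by exact_mod_cast (by linarith : 0 < s + (t + 1)).ne'
  have h6 : ((t + (s + 1) : ℝ) : ℂ) = (s : ℂ) + (t + 1) := by push_cast; ring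
  have h7 : ((s + (t + 1) : ℝ) : ℂ) = (s : ℂ) + (t + 1) := by push_cast; ring
  simp only [tricomiKernelFlux, tricomiKernelDeriv, h6, h7, tricomiKernel_sub_one_left _ _ _ hs,
    tricomiKernel_sub_one_left _ _ _ ht, tricomiKernel_sub_one_right _ _ _ hs,
    tricomiKernel_sub_one_right _ _ _ ht]
  generalize tricomiKernel (-z) z' x s = A
  generalize tricomiKernel (-z') z y t = B
  field_simp
  ring

lemma sub_mul_integral_tricomiKernel_mul {z z' : ℂ} {x y : ℝ}
    (hz₂ : z.re < 0) (hz'₂ : z'.re < 0) (hx : 0 < x) (hy : 0 < y) :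
    ((x : ℂ) - y) * ∫ p in (Set.Ioi (0 : ℝ)) ×ˢ (Set.Ioi (0 : ℝ)),
        tricomiKernel (-z) z' x p.1 * tricomiKernel (-z') z y p.2 *
          ((p.1 + (p.2 + 1) : ℝ) : ℂ)⁻¹ =
      -z * ((∫ t in Set.Ioi (0 : ℝ), tricomiKernel (-z - 1) z' x t) *
          ∫ t in Set.Ioi (0 : ℝ), tricomiKernel (-z') (z - 1) y t) +
        z' * ((∫ t in Set.Ioi (0 : ℝ), tricomiKernel (-z) (z' - 1) x t) *
          ∫ t in Set.Ioi (0 : ℝ), tricomiKernel (-z' - 1) z y t) := by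
  have hza : 0 < (-z).re := by simpa using hz₂
  have hza' : 0 < (-z').re := by simpa using hz'₂
  have hzb : -1 < (-z - 1).re := by simpa using hz₂
  have hzb' : -1 < (-z' - 1).re := by simpa using hz'₂
  have hzc : (z - 1).re ≤ 0 := by simp; linarith
  have hzc' : (z' - 1).re ≤ 0 := by simp; linarith
  have hu := integrableOn_tricomiKernel (a := -z) (b := z') (by linarith) hz'₂.le hx
  have hv := integrableOn_tricomiKernel (a := -z') (b := z) (by linarith) hz₂.le hy
  have hP := integrable_tricomiKernelFlux hza hz'₂.le hx hv
  have hQ := integrable_tricomiKernelFlux hza' hz₂.le hy hu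
  have hP0 := integral_tricomiKernelFlux hza hz'₂.le hx hv
  have hQ0 := integral_tricomiKernelFlux hza' hz₂.le hy hu
  rw [← integral_prod_swap] at hQ0
  have hdiff := integral_sub hP hQ.swap
  have hA := (Integrable.mul_prod (integrableOn_tricomiKernel hzb hz'₂.le hx)
    (integrableOn_tricomiKernel (a := -z') (by linarith) hzc hy)).const_mul (-z)
  have hB := (Integrable.mul_prod (integrableOn_tricomiKernel (a := -z) (by linarith) hzc' hx)
    (integrableOn_tricomiKernel hzb' hz₂.le hy)).const_mul z'
  have hC := (integrable_mul_inv_add hu hv).const_mul ((x : ℂ) - y)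
  have hsum := integral_sub (hA.add hB) hC
  have hsum' := integral_add hA hB
  simp only [Pi.add_apply] at hsum
  rw [hsum', integral_const_mul, integral_const_mul, integral_const_mul, integral_prod_mul,
    integral_prod_mul] at hsum
  have hae : ∀ᵐ p : ℝ × ℝ ∂((volume.restrict (Set.Ioi 0)).prod (volume.restrict (Set.Ioi 0))),
      p ∈ Set.Ioi (0 : ℝ) ×ˢ Set.Ioi (0 : ℝ) := by
    rw [Measure.prod_restrict]
    exact ae_restrict_mem (measurableSet_Ioi.prod measurableSet_Ioi)
  have hcongr := integral_congr_ae (hae.mono fun p hp =>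
    tricomiKernelFlux_sub_swap z z' x y (Set.mem_Ioi.1 hp.1) (Set.mem_Ioi.1 hp.2))
  rw [Measure.volume_eq_prod, ← Measure.prod_restrict]
  simp only [Function.comp_def, Prod.swap] at hdiff hQ0
  rw [hP0, hQ0, sub_zero] at hdiff
  exact (sub_eq_zero.1 (hsum.symm.trans (hcongr.symm.trans hdiff))).symm

lemma setIntegral_phi_mul (a b : ℂ) (x : ℝ) :
    ∫ t in Set.Ioi (0 : ℝ), phi a t * ((t + 1 : ℝ) : ℂ) ^ b * (Real.exp (-x * t) : ℂ) =
      (Complex.Gamma (a + 1))⁻¹ * ∫ t in Set.Ioi (0 : ℝ), tricomiKernel a b x t := by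
  rw [← integral_const_mul]
  refine setIntegral_congr_fun measurableSet_Ioi fun t (ht : 0 < t) => ?_
  simp only [phi, ht, if_true, tricomiKernel]
  ring

lemma Complex.Gamma_ne_zero_of_neg_one_lt_re {s : ℂ} (h₁ : -1 < s.re) (h₀ : s ≠ 0) :
    Complex.Gamma s ≠ 0 := by
  intro h
  have h' := Complex.Gamma_add_one s h₀
  rw [h, mul_zero] at h'
  exact Complex.Gamma_ne_zero_of_re_pos (by simp; linarith) h'

theorem whittaker_kernel_integration_by_parts (z z' : ℂ)
    (hz₁ : -1 < z.re) (hz₂ : z.re < 0) (hz'₁ : -1 < z'.re) (hz'₂ : z'.re < 0)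
    (x y : ℝ) (hx : 0 < x) (hy : 0 < y) :
    ((x : ℂ) - (y : ℂ)) *
        (z * z' *
          ∫ p in (Set.Ioi (0:ℝ)) ×ˢ (Set.Ioi (0:ℝ)),
            phi (-z) p.1 * phi (-z') p.2 * phi z' (p.1 + 1) * phi z (p.2 + 1) *
              (Real.exp (-x * (p.1 + 1/2) - y * (p.2 + 1/2)) : ℂ) /
                ((p.1 : ℂ) + (p.2 : ℂ) + 1)) =
      ((Real.exp (-(x + y) / 2) : ℂ) / (Complex.Gamma z * Complex.Gamma z')) *
        ((∫ t₁ in Set.Ioi (0:ℝ),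
              phi (-z - 1) t₁ * ((t₁ + 1 : ℝ) : ℂ) ^ z' * (Real.exp (-x * t₁) : ℂ)) *
            (∫ t₂ in Set.Ioi (0:ℝ),
              phi (-z') t₂ * ((t₂ + 1 : ℝ) : ℂ) ^ (z - 1) * (Real.exp (-y * t₂) : ℂ)) -
          (∫ t₁ in Set.Ioi (0:ℝ),
              phi (-z) t₁ * ((t₁ + 1 : ℝ) : ℂ) ^ (z' - 1) * (Real.exp (-x * t₁) : ℂ)) *
            (∫ t₂ in Set.Ioi (0:ℝ),
              phi (-z' - 1) t₂ * ((t₂ + 1 : ℝ) : ℂ) ^ z * (Real.exp (-y * t₂) : ℂ))) := by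
  have hz0 : z ≠ 0 := fun h => by simp [h] at hz₂
  have hz'0 : z' ≠ 0 := fun h => by simp [h] at hz'₂
  have hG := Complex.Gamma_ne_zero_of_neg_one_lt_re hz₁ hz0
  have hG' := Complex.Gamma_ne_zero_of_neg_one_lt_re hz'₁ hz'0
  have hN : Complex.Gamma (-z) ≠ 0 := Complex.Gamma_ne_zero_of_re_pos (by simpa using hz₂)
  have hN' : Complex.Gamma (-z') ≠ 0 := Complex.Gamma_ne_zero_of_re_pos (by simpa using hz'₂)
  have hM : ∫ p in (Set.Ioi (0:ℝ)) ×ˢ (Set.Ioi (0:ℝ)),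
      phi (-z) p.1 * phi (-z') p.2 * phi z' (p.1 + 1) * phi z (p.2 + 1) *
        (Real.exp (-x * (p.1 + 1/2) - y * (p.2 + 1/2)) : ℂ) / ((p.1 : ℂ) + (p.2 : ℂ) + 1) =
      ((Real.exp (-(x + y) / 2) : ℂ) / (Complex.Gamma (-z + 1) * Complex.Gamma (-z' + 1) *
        Complex.Gamma (z' + 1) * Complex.Gamma (z + 1))) *
        ∫ p in (Set.Ioi (0 : ℝ)) ×ˢ (Set.Ioi (0 : ℝ)),
          tricomiKernel (-z) z' x p.1 * tricomiKernel (-z') z y p.2 *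
            ((p.1 + (p.2 + 1) : ℝ) : ℂ)⁻¹ := by
    rw [← integral_const_mul]
    refine setIntegral_congr_fun (measurableSet_Ioi.prod measurableSet_Ioi) ?_
    rintro ⟨s, t⟩ ⟨hs, ht⟩
    simp only [Set.mem_Ioi] at hs ht
    have hs1 : 0 < s + 1 := by linarith
    have ht1 : 0 < t + 1 := by linarith
    have hexp : Real.exp (-x * (s + 1/2) - y * (t + 1/2)) =
        Real.exp (-(x + y) / 2) * Real.exp (-x * s) * Real.exp (-y * t) := by
      rw [← Real.exp_add, ← Real.exp_add]
      congr 1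
      ring
    have hden : (s : ℂ) + t + 1 = ((s + (t + 1) : ℝ) : ℂ) := by push_cast; ring
    simp only [phi, hs, ht, hs1, ht1, if_true, tricomiKernel]
    rw [hexp, hden, Complex.ofReal_mul, Complex.ofReal_mul]
    simp only [div_eq_mul_inv, mul_inv]
    ring
  have key := sub_mul_integral_tricomiKernel_mul hz₂ hz'₂ hx hy
  rw [hM, setIntegral_phi_mul, setIntegral_phi_mul, setIntegral_phi_mul, setIntegral_phi_mul,
    sub_add_cancel, sub_add_cancel, Complex.Gamma_add_one z hz0, Complex.Gamma_add_one z' hz'0,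
    Complex.Gamma_add_one (-z) (neg_ne_zero.2 hz0),
    Complex.Gamma_add_one (-z') (neg_ne_zero.2 hz'0), mul_left_comm, mul_left_comm _ (_ / _), key]
  field_simp
  ring
end
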